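/- arXiv:1907.08108 — 7 statements merged into one kernel-verified Lean document; each statement's English description precedes it below -/
import Mathlib

section
/- Let N ≥ 1 be an integer and k = (k₁,k₂) ∈ ℕ². If P^{(N)}_k is a type II multiple orthogonal polynomial for the weights e^{−NV₁}, e^{−NV₂}, then all k₁ + k₂ zeros of P^{(N)}_k are real and simple; that is, P^{(N)}_k has exactly k₁ + k₂ pairwise distinct real roots. -/
open MeasureTheory Polynomial

/-- Type II multiple orthogonal polynomial for the weights `e^{-N V₁}`, `e^{-N V₂}`,
where `V₁(x) = V(x) - a·x` and `V₂(x) = V(x) + a·x`: a monic real polynomial of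
degree `k₁ + k₂` satisfying the multiple orthogonality conditions. -/
def IsTypeIIMOP (V : Polynomial ℝ) (a : ℝ) (N : ℕ) (k₁ k₂ : ℕ) (P : Polynomial ℝ) : Prop :=
  P.Monic ∧ P.natDegree = k₁ + k₂ ∧
  (∀ l < k₁, ∫ x : ℝ, P.eval x * x ^ l * Real.exp (-(N : ℝ) * (V.eval x - a * x)) = 0) ∧
  (∀ l < k₂, ∫ x : ℝ, P.eval x * x ^ l * Real.exp (-(N : ℝ) * (V.eval x + a * x)) = 0)

open Filter Topology Set

/-- A continuous real function without zeros has constant sign. -/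
lemma Continuous.forall_pos_or_forall_neg {h : ℝ → ℝ} (hc : Continuous h)
    (h0 : ∀ x, h x ≠ 0) : (∀ x, 0 < h x) ∨ (∀ x, h x < 0) := by
  by_contra! H
  obtain ⟨⟨x, hx⟩, y, hy⟩ := H
  obtain ⟨z, hz⟩ := mem_range_of_exists_le_of_exists_ge hc ⟨x, hx⟩ ⟨y, hy⟩
  exact h0 z hz

/-- Factoring out the real zeros of odd multiplicity leaves a polynomial of constant sign. -/
lemma Polynomial.exists_eq_mul_prod_X_sub_C_of_sign (P : ℝ[X]) :
    ∃ (S : Finset ℝ) (q : ℝ[X]), P = q * ∏ s ∈ S, (X - C s) ∧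
      ((∀ x, 0 ≤ q.eval x) ∨ ∀ x, q.eval x ≤ 0) := by
  induction hn : P.natDegree generalizing P with
  | zero =>
    refine ⟨∅, P, by simp, ?_⟩
    rw [eq_C_of_natDegree_eq_zero hn]
    simpa using le_total 0 (P.coeff 0)
  | succ n ih =>
    by_cases hr : ∃ r, P.eval r = 0
    · obtain ⟨r, hr⟩ := hr
      obtain ⟨P₁, rfl⟩ := dvd_iff_isRoot.mpr hr
      have hP₁ : P₁ ≠ 0 := by
        rintro rfl
        simp at hn
      rw [natDegree_mul (X_sub_C_ne_zero r) hP₁, natDegree_X_sub_C] at hn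
      obtain ⟨S, q, hq, hs⟩ := ih P₁ (by lia)
      by_cases hrS : r ∈ S
      · refine ⟨S.erase r, (X - C r) ^ 2 * q, ?_, ?_⟩
        · rw [hq, ← Finset.mul_prod_erase S _ hrS]
          ring
        · refine hs.imp (fun h x ↦ ?_) (fun h x ↦ ?_)
          · simpa using mul_nonneg (sq_nonneg (x - r)) (h x)
          · simpa using mul_nonpos_of_nonneg_of_nonpos (sq_nonneg (x - r)) (h x)
      · refine ⟨insert r S, q, ?_, hs⟩
        rw [hq, Finset.prod_insert hrS]
        ring
    · push Not at hr
      exact ⟨∅, P, by simp, (P.continuous.forall_pos_or_forall_neg hr).imp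
        (fun h x ↦ (h x).le) fun h x ↦ (h x).le⟩

/-- Rolle's theorem for finitely many zeros: the derivative of a function vanishing on `T` has at
least `#T - 1` zeros outside `T`. -/
lemma exists_finset_hasDerivAt_eq_zero {f f' : ℝ → ℝ} (hf : ∀ x, HasDerivAt f (f' x) x)
    (T : Finset ℝ) (hT : ∀ x ∈ T, f x = 0) :
    ∃ U : Finset ℝ, Disjoint U T ∧ (∀ x ∈ U, f' x = 0) ∧ T.card ≤ U.card + 1 := by
  have key : ∀ x ∈ T, ∀ y ∈ T, x < y → ∃ z, z ∈ Ioo x y ∧ f' z = 0 := fun x hx y hy hxy ↦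
    exists_hasDerivAt_eq_zero hxy (fun z _ ↦ (hf z).continuousAt.continuousWithinAt)
      (by rw [hT x hx, hT y hy]) fun z _ ↦ hf z
  classical
  choose! c hc using key
  set U := ((T ×ˢ T).filter fun p ↦ p.1 < p.2).image fun p ↦ c p.1 p.2 with hU
  refine ⟨U \ T, Finset.sdiff_disjoint, fun z hz ↦ ?_, ?_⟩
  · obtain ⟨p, hp, rfl⟩ := Finset.mem_image.mp (Finset.mem_sdiff.mp hz).1
    simp only [Finset.mem_filter, Finset.mem_product] at hp
    exact (hc _ hp.1.1 _ hp.1.2 hp.2).2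
  · refine Finset.card_le_sdiff_of_interleaved fun x hx y hy hxy _ ↦ ⟨c x y, ?_, ?_⟩
    · exact Finset.mem_image.mpr ⟨(x, y), by simp [hx, hy, hxy], rfl⟩
    · exact (hc x hx y hy hxy).1

/-- The exponential polynomial `A(x) + B(x) e^{c x}`. -/
noncomputable def expPoly (c : ℝ) (A B : ℝ[X]) (x : ℝ) : ℝ :=
  A.eval x + B.eval x * Real.exp (c * x)

lemma hasDerivAt_expPoly (c : ℝ) (A B : ℝ[X]) (x : ℝ) :
    HasDerivAt (expPoly c A B) (expPoly c (derivative A) (derivative B + C c * B) x) x := by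
  have h : HasDerivAt (fun x : ℝ ↦ Real.exp (c * x)) (Real.exp (c * x) * c) x := by
    simpa using ((hasDerivAt_id x).const_mul c).exp
  refine ((A.hasDerivAt x).add ((B.hasDerivAt x).mul h)).congr_deriv ?_
  simp only [expPoly, eval_add, eval_mul, eval_C]
  ring

/-- A nonzero exponential polynomial `A + B e^{c x}` with `deg A < m` and `deg B < n` has fewer
than `m + n` real zeros, where zeros at which the derivative also vanishes count twice. -/
lemma card_zeros_expPoly_lt {c : ℝ} (hc : c ≠ 0) (m n : ℕ) (A B : ℝ[X]) (hA : A.degree < m)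
    (hB : B.degree < n) (hAB : A ≠ 0 ∨ B ≠ 0) (T U : Finset ℝ) (hUT : U ⊆ T)
    (hT : ∀ x ∈ T, expPoly c A B x = 0)
    (hU : ∀ x ∈ U, expPoly c (derivative A) (derivative B + C c * B) x = 0) :
    T.card + U.card < m + n := by
  induction m generalizing A B T U with
  | zero =>
    obtain rfl : A = 0 := by simpa using hA
    replace hAB : B ≠ 0 := by simpa using hAB
    have hBT : ∀ x ∈ T, B.eval x = 0 := fun x hx ↦ by
      simpa [expPoly, Real.exp_ne_zero] using hT x hx
    have hBU : ∀ x ∈ U, (derivative B).eval x = 0 := fun x hx ↦ by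
      simpa [expPoly, Real.exp_ne_zero, hBT x (hUT hx)] using hU x hx
    have hle : T.val + U.val ≤ B.roots := by
      rw [Multiset.le_iff_count]
      intro x
      rw [Multiset.count_add, count_roots]
      by_cases hxU : x ∈ U
      · have h1 := (one_lt_rootMultiplicity_iff_isRoot hAB).mpr ⟨hBT x (hUT hxU), hBU x hxU⟩
        have h2 := Multiset.nodup_iff_count_le_one.mp T.nodup x
        have h3 := Multiset.nodup_iff_count_le_one.mp U.nodup x
        lia
      · have h3 : Multiset.count x U.val = 0 := Multiset.count_eq_zero.mpr hxU
        by_cases hxT : x ∈ T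
        · have h1 := (rootMultiplicity_pos hAB).mpr (hBT x hxT)
          have h2 := Multiset.nodup_iff_count_le_one.mp T.nodup x
          lia
        · have h2 : Multiset.count x T.val = 0 := Multiset.count_eq_zero.mpr hxT
          lia
    have h1 := Multiset.card_le_card hle
    have h2 := B.card_roots'
    have h3 := (natDegree_lt_iff_degree_lt hAB).mpr hB
    simp only [Multiset.card_add, Finset.card_val] at h1
    lia
  | succ m ih =>
    obtain ⟨W, hWT, hW, hcard⟩ := exists_finset_hasDerivAt_eq_zero (hasDerivAt_expPoly c A B) T hT
    have hcB : (C c * B).degree = B.degree := by rw [degree_C_mul hc]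
    have hB' : (derivative B + C c * B).degree = B.degree := by
      by_cases hB0 : B = 0
      · simp [hB0]
      · rw [degree_add_eq_right_of_degree_lt, hcB]
        rw [hcB]
        exact degree_derivative_lt hB0
    by_cases h0 : derivative A ≠ 0 ∨ derivative B + C c * B ≠ 0
    · have hA' : (derivative A).degree < m := by
        by_cases hd : derivative A = 0
        · simp [hd]
        have hA0 : A ≠ 0 := by
          rintro rfl
          simp at hd
        have h1 : A.natDegree < m + 1 := (natDegree_lt_iff_degree_lt hA0).mpr (by exact_mod_cast hA)
        have h2 : A.natDegree ≠ 0 := fun h ↦ hd (derivative_of_natDegree_zero h)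
        refine (natDegree_lt_iff_degree_lt hd).mp ?_
        have := natDegree_derivative_lt h2
        lia
      have := ih (derivative A) _ hA' (hB'.trans_lt hB) h0 (W ∪ U) ∅ (by simp)
        (fun x hx ↦ (Finset.mem_union.mp hx).elim (hW x) (hU x)) (by simp)
      rw [Finset.card_union_of_disjoint (hWT.mono_right hUT)] at this
      simp only [Finset.card_empty] at this
      lia
    · push Not at h0
      obtain rfl : B = 0 := by
        rw [← degree_eq_bot, ← hB', h0.2, degree_zero]
      have hAc := eq_C_of_natDegree_eq_zero (derivative_eq_zero.mp h0.1)
      have hT0 : T = ∅ := by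
        refine Finset.eq_empty_of_forall_notMem fun x hx ↦ ?_
        have := hT x hx
        rw [hAc] at this
        simp only [expPoly, eval_C, eval_zero, zero_mul, add_zero] at this
        rw [this] at hAc
        simp [hAc] at hAB
      subst hT0
      rw [Finset.subset_empty.mp hUT]
      simp

/-- Prescribed zeros: one free coefficient more than prescribed zeros suffices. -/
lemma exists_expPoly_eq_zero (c : ℝ) (S : Finset ℝ) (m n : ℕ) (h : S.card < m + n) :
    ∃ A B : ℝ[X], A.degree < m ∧ B.degree < n ∧ (A ≠ 0 ∨ B ≠ 0) ∧
      ∀ s ∈ S, expPoly c A B s = 0 := by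
  let F : (Fin m → ℝ) × (Fin n → ℝ) →ₗ[ℝ] (S → ℝ) :=
    LinearMap.pi fun s ↦
      ((leval (s : ℝ)).comp ((degreeLT ℝ m).subtype.comp (degreeLTEquiv ℝ m).symm.toLinearMap)).coprod
        (Real.exp (c * s) •
          (leval (s : ℝ)).comp ((degreeLT ℝ n).subtype.comp (degreeLTEquiv ℝ n).symm.toLinearMap))
  have hF : LinearMap.ker F ≠ ⊥ := LinearMap.ker_ne_bot_of_finrank_lt (by simpa using h)
  obtain ⟨⟨u, v⟩, huv, h0⟩ := (Submodule.ne_bot_iff _).mp hF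
  refine ⟨(degreeLTEquiv ℝ m).symm u, (degreeLTEquiv ℝ n).symm v,
    mem_degreeLT.mp (Subtype.property _), mem_degreeLT.mp (Subtype.property _), ?_, fun s hs ↦ ?_⟩
  · contrapose! h0
    simpa using h0
  · have := congrFun (LinearMap.mem_ker.mp huv) ⟨s, hs⟩
    simpa [F, expPoly, mul_comm] using this

/-- A differentiable function whose zeros are simple and finite in number is, up to a continuous
factor without zeros, the monic polynomial with the same zeros. -/
lemma exists_continuous_eq_mul_prod_sub {f f' : ℝ → ℝ} (hf : ∀ x, HasDerivAt f (f' x) x)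
    (S : Finset ℝ) (hS : ∀ x, f x = 0 ↔ x ∈ S) (hS' : ∀ x ∈ S, f' x ≠ 0) :
    ∃ h : ℝ → ℝ, Continuous h ∧ (∀ x, h x ≠ 0) ∧
      ∀ x, f x = h x * (∏ s ∈ S, (X - C s)).eval x := by
  classical
  set p : ℝ[X] := ∏ s ∈ S, (X - C s) with hp
  have hp0 : ∀ x, p.eval x = 0 ↔ x ∈ S := fun x ↦ by
    simp [hp, eval_prod, Finset.prod_eq_zero_iff, sub_eq_zero]
  have hp' : ∀ x ∈ S, (derivative p).eval x ≠ 0 := fun x hx ↦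
    (separable_prod_X_sub_C_iff'.mpr fun _ _ _ _ h ↦ h).eval₂_derivative_ne_zero (RingHom.id ℝ)
      ((hp0 x).mpr hx)
  refine ⟨fun x ↦ if x ∈ S then f' x / (derivative p).eval x else f x / p.eval x,
    continuous_iff_continuousAt.mpr fun x ↦ ?_, fun x ↦ ?_, fun x ↦ ?_⟩
  · by_cases hx : x ∈ S
    · rw [continuousAt_iff_punctured_nhds, if_pos hx]
      refine ((hf x).tendsto_slope.div (p.hasDerivAt x).tendsto_slope (hp' x hx)).congr' ?_
      have h1 : ∀ᶠ y in 𝓝[≠] x, y ∉ (S.erase x : Set ℝ) :=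
        nhdsWithin_le_nhds ((S.erase x).finite_toSet.isClosed.isOpen_compl.mem_nhds (by simp))
      filter_upwards [h1, self_mem_nhdsWithin] with y hy hyx
      have hyx : y ≠ x := hyx
      have hyS : y ∉ S := fun h ↦ hy (by simp [h, hyx])
      rw [if_neg hyS, Pi.div_apply, slope_def_field, slope_def_field, (hS x).mpr hx,
        (hp0 x).mpr hx, sub_zero, sub_zero, div_div_div_cancel_right₀ (sub_ne_zero.mpr hyx)]
    · refine ContinuousAt.congr
        ((hf x).continuousAt.div p.continuousAt fun h ↦ hx ((hp0 x).mp h)) ?_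
      filter_upwards [S.finite_toSet.isClosed.isOpen_compl.mem_nhds hx] with y hy
      exact (if_neg hy).symm
  · dsimp only
    split_ifs with hx
    · exact div_ne_zero (hS' x hx) (hp' x hx)
    · exact div_ne_zero (fun h ↦ hx ((hS x).mp h)) fun h ↦ hx ((hp0 x).mp h)
  · dsimp only
    split_ifs with hx
    · rw [(hS x).mpr hx, (hp0 x).mpr hx, mul_zero]
    · rw [div_mul_cancel₀ _ fun h ↦ hx ((hp0 x).mp h)]

lemma Polynomial.integrableOn_Ioi_mul_exp_neg {W : ℝ[X]} (hdeg : 2 ≤ W.natDegree)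
    (hlead : 0 < W.leadingCoeff) (Q : ℝ[X]) :
    IntegrableOn (fun x ↦ Q.eval x * Real.exp (-W.eval x)) (Ioi 0) := by
  refine integrable_of_isBigO_exp_neg one_pos (by fun_prop) ?_
  have hQ : (fun x ↦ Q.eval x) =O[atTop] Real.exp := by
    refine Q.isEquivalent_atTop_lead.isBigO.trans ?_
    exact Real.isLittleO_pow_exp_atTop.isBigO.const_mul_left _
  have hd : (C 2 * X : ℝ[X]).degree < W.degree := by
    refine (degree_C_mul_X_le 2).trans_lt ?_
    rw [degree_eq_natDegree (leadingCoeff_ne_zero.mp hlead.ne')]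
    exact_mod_cast hdeg
  have hW : Tendsto (fun x ↦ (W - C 2 * X).eval x) atTop atTop := by
    refine tendsto_atTop_of_leadingCoeff_nonneg _ ?_ ?_
    · rw [degree_sub_eq_left_of_degree_lt hd]
      exact natDegree_pos_iff_degree_pos.mp (by lia)
    · rw [leadingCoeff_sub_of_degree_lt hd]
      exact hlead.le
  have hexp : (fun x ↦ Real.exp (-W.eval x)) =O[atTop] fun x ↦ Real.exp (-2 * x) := by
    refine Asymptotics.IsBigO.of_bound 1 ?_
    filter_upwards [hW.eventually_ge_atTop 0] with x hx
    simp only [eval_sub, eval_mul, eval_C, eval_X] at hx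
    rw [Real.norm_eq_abs, Real.norm_eq_abs, Real.abs_exp, Real.abs_exp, one_mul, Real.exp_le_exp]
    linarith
  refine (hQ.mul hexp).congr_right fun x ↦ ?_
  rw [← Real.exp_add]
  ring_nf

/-- Polynomials are integrable against `e^{-W}` when `W` has positive even degree and positive
leading coefficient. -/
lemma Polynomial.integrable_mul_exp_neg {W : ℝ[X]} (hdeg : 2 ≤ W.natDegree)
    (heven : Even W.natDegree) (hlead : 0 < W.leadingCoeff) (Q : ℝ[X]) :
    Integrable fun x ↦ Q.eval x * Real.exp (-W.eval x) := by
  rw [← integrableOn_univ, ← Iic_union_Ioi (a := (0 : ℝ)), integrableOn_union]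
  refine ⟨?_, integrableOn_Ioi_mul_exp_neg hdeg hlead Q⟩
  have hneg : (-X : ℝ[X]).natDegree = 1 := by rw [natDegree_neg, natDegree_X]
  have hdeg' : 2 ≤ (W.comp (-X)).natDegree := by rwa [natDegree_comp, hneg, mul_one]
  have hlead' : 0 < (W.comp (-X)).leadingCoeff := by
    rw [leadingCoeff_comp (by rw [hneg]; exact one_ne_zero), leadingCoeff_neg, leadingCoeff_X,
      heven.neg_one_pow, mul_one]
    exact hlead
  have h : IntegrableOn (fun x ↦ (Q.comp (-X)).eval x * Real.exp (-(W.comp (-X)).eval x))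
      (Ioi (-0)) := by
    rw [neg_zero]
    exact integrableOn_Ioi_mul_exp_neg hdeg' hlead' (Q.comp (-X))
  rw [integrableOn_Iic_iff_integrableOn_Iio]
  simpa using h.comp_neg_Iio

/-- A continuous function of constant sign with vanishing integral is zero. -/
lemma Continuous.eq_zero_of_integral_eq_zero {F : ℝ → ℝ} (hc : Continuous F) (hi : Integrable F)
    (hs : (∀ x, 0 ≤ F x) ∨ ∀ x, F x ≤ 0) (h0 : ∫ x, F x = 0) : F = 0 := by
  wlog hpos : ∀ x, 0 ≤ F x generalizing F
  · have hs' : ∀ x, 0 ≤ (-F) x := fun x ↦ neg_nonneg.mpr (hs.resolve_left hpos x)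
    refine neg_eq_zero.mp (this hc.neg hi.neg (Or.inl hs') ?_ hs')
    simpa [integral_neg] using h0
  exact (Continuous.ae_eq_iff_eq volume hc continuous_const).mp
    ((integral_eq_zero_iff_of_nonneg hpos hi).mp h0)

/-- Orthogonality to monomials of low degree extends to polynomials of low degree. -/
lemma Polynomial.integral_mul_eval_mul_eq_zero {P : ℝ[X]} {w : ℝ → ℝ} {k : ℕ}
    (hi : ∀ Q : ℝ[X], Integrable fun x ↦ Q.eval x * w x)
    (h0 : ∀ l < k, ∫ x, P.eval x * x ^ l * w x = 0) {A : ℝ[X]} (hA : A.degree < k) :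
    ∫ x, (P * A).eval x * w x = 0 := by
  by_cases hA0 : A = 0
  · simp [hA0]
  have hA' := (natDegree_lt_iff_degree_lt hA0).mpr hA
  have hsum : ∀ x, (P * A).eval x * w x =
      ∑ l ∈ Finset.range k, A.coeff l * ((P * X ^ l).eval x * w x) := fun x ↦ by
    rw [eval_mul, A.eval_eq_sum_range' hA', Finset.mul_sum, Finset.sum_mul]
    refine Finset.sum_congr rfl fun l _ ↦ ?_
    simp only [eval_mul, eval_pow, eval_X]
    ring
  simp_rw [hsum]
  rw [integral_finsetSum _ fun l _ ↦ (hi _).const_mul _]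
  refine Finset.sum_eq_zero fun l hl ↦ ?_
  rw [integral_const_mul]
  simp only [eval_mul, eval_pow, eval_X]
  rw [h0 l (Finset.mem_range.mp hl), mul_zero]

lemma Polynomial.integrable_mul_exp_neg_linear_perturbation {V : ℝ[X]} (hdeg : 2 ≤ V.natDegree)
    (heven : Even V.natDegree) (hlead : 0 < V.leadingCoeff) {N : ℝ} (hN : 0 < N) (b : ℝ)
    (Q : ℝ[X]) : Integrable fun x ↦ Q.eval x * Real.exp (-N * (V.eval x + b * x)) := by
  have hd : (C b * X : ℝ[X]).degree < V.degree := by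
    refine (degree_C_mul_X_le b).trans_lt ?_
    rw [degree_eq_natDegree (leadingCoeff_ne_zero.mp hlead.ne')]
    exact_mod_cast hdeg
  have hnat : (C N * (V + C b * X)).natDegree = V.natDegree := by
    rw [natDegree_C_mul hN.ne', natDegree_eq_of_degree_eq (degree_add_eq_left_of_degree_lt hd)]
  have hl : 0 < (C N * (V + C b * X)).leadingCoeff := by
    rw [leadingCoeff_mul, leadingCoeff_C, leadingCoeff_add_of_degree_lt' hd]
    exact mul_pos hN hlead
  simpa using integrable_mul_exp_neg (by rwa [hnat]) (by rwa [hnat]) hl Q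

/-- **Zeros of type II MOPs are real and simple**: `P^{(N)}_k` has exactly `k₁ + k₂`
pairwise distinct real roots. -/
theorem stmt1 (V : Polynomial ℝ) (hVdeg : 2 ≤ V.natDegree) (hVeven : Even V.natDegree)
    (hVlead : 0 < V.leadingCoeff) (hV0 : V.coeff 0 = 0)
    (a : ℝ) (ha : 0 < a) (N : ℕ) (hN : 1 ≤ N) (k₁ k₂ : ℕ) (P : Polynomial ℝ)
    (hP : IsTypeIIMOP V a N k₁ k₂ P) :
    ∃ S : Finset ℝ, S.card = k₁ + k₂ ∧ ∀ x ∈ S, P.eval x = 0 := by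
  obtain ⟨hmonic, -, hP₁, hP₂⟩ := hP
  obtain ⟨S, q, hPq, hq⟩ := P.exists_eq_mul_prod_X_sub_C_of_sign
  have hSP : ∀ x ∈ S, P.eval x = 0 := fun x hx ↦ by
    rw [hPq, eval_mul, eval_prod, Finset.prod_eq_zero hx (by simp), mul_zero]
  rcases le_or_gt (k₁ + k₂) S.card with hS | hS
  · obtain ⟨T, hTS, hT⟩ := Finset.exists_subset_card_eq hS
    exact ⟨T, hT, fun x hx ↦ hSP x (hTS hx)⟩
  exfalso
  have hN' : (0 : ℝ) < N := by exact_mod_cast hN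
  obtain ⟨m, n, hm, hn, hmn⟩ : ∃ m n, m ≤ k₁ ∧ n ≤ k₂ ∧ m + n = S.card + 1 :=
    ⟨min k₁ (S.card + 1), S.card + 1 - min k₁ (S.card + 1), by lia, by lia, by lia⟩
  set c : ℝ := -(2 * N * a) with hcdef
  have hc : c ≠ 0 := by
    have : 0 < 2 * N * a := by positivity
    exact neg_ne_zero.mpr this.ne'
  obtain ⟨A, B, hA, hB, hAB, hzero⟩ := exists_expPoly_eq_zero c S m n (by lia)
  have hiff : ∀ x, expPoly c A B x = 0 ↔ x ∈ S := fun x ↦ by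
    refine ⟨fun hx ↦ ?_, hzero x⟩
    by_contra hxS
    have := card_zeros_expPoly_lt hc m n A B hA hB hAB (insert x S) ∅ (by simp)
      (by simpa [hx] using hzero) (by simp)
    rw [Finset.card_insert_of_notMem hxS, Finset.card_empty] at this
    lia
  have hsimple : ∀ x ∈ S, expPoly c (derivative A) (derivative B + C c * B) x ≠ 0 := fun x hx h ↦ by
    have := card_zeros_expPoly_lt hc m n A B hA hB hAB S {x} (by simpa using hx) hzero
      (by simpa using h)
    rw [Finset.card_singleton] at this
    lia
  obtain ⟨h, hcont, hne, hfac⟩ :=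
    exists_continuous_eq_mul_prod_sub (hasDerivAt_expPoly c A B) S hiff hsimple
  set w : ℝ → ℝ := fun x ↦ Real.exp (-(N : ℝ) * (V.eval x - a * x)) with hw
  set w' : ℝ → ℝ := fun x ↦ Real.exp (-(N : ℝ) * (V.eval x + a * x)) with hw'
  have hi (Q : ℝ[X]) : Integrable fun x ↦ Q.eval x * w x := by
    simpa [hw, sub_eq_add_neg] using
      integrable_mul_exp_neg_linear_perturbation hVdeg hVeven hVlead hN' (-a) Q
  have hi' (Q : ℝ[X]) : Integrable fun x ↦ Q.eval x * w' x :=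
    integrable_mul_exp_neg_linear_perturbation hVdeg hVeven hVlead hN' a Q
  have hsplit : (fun x ↦ P.eval x * expPoly c A B x * w x) =
      fun x ↦ (P * A).eval x * w x + (P * B).eval x * w' x := by
    funext x
    have hww : w' x = Real.exp (c * x) * w x := by
      simp only [hw, hw', ← Real.exp_add, hcdef]
      congr 1
      ring
    rw [hww, expPoly, eval_mul, eval_mul]
    ring
  have hint : Integrable fun x ↦ P.eval x * expPoly c A B x * w x := by
    rw [hsplit]
    exact (hi _).add (hi' _)
  have hint0 : ∫ x, P.eval x * expPoly c A B x * w x = 0 := by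
    rw [hsplit, integral_add (hi _) (hi' _),
      integral_mul_eval_mul_eq_zero hi hP₁ (hA.trans_le (by exact_mod_cast hm)),
      integral_mul_eval_mul_eq_zero hi' hP₂ (hB.trans_le (by exact_mod_cast hn)), add_zero]
  have hform (x : ℝ) : P.eval x * expPoly c A B x * w x =
      q.eval x * h x * (((∏ s ∈ S, (X - C s)).eval x) ^ 2 * w x) := by
    rw [hfac, hPq, eval_mul]
    ring
  have hsq (x : ℝ) : 0 ≤ ((∏ s ∈ S, (X - C s)).eval x) ^ 2 * w x := by positivity
  have hsign : (∀ x, 0 ≤ P.eval x * expPoly c A B x * w x) ∨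
      ∀ x, P.eval x * expPoly c A B x * w x ≤ 0 := by
    simp_rw [hform]
    rcases hq with hq | hq <;> rcases hcont.forall_pos_or_forall_neg hne with hh | hh
    · exact Or.inl fun x ↦ mul_nonneg (mul_nonneg (hq x) (hh x).le) (hsq x)
    · exact Or.inr fun x ↦ mul_nonpos_of_nonpos_of_nonneg
        (mul_nonpos_of_nonneg_of_nonpos (hq x) (hh x).le) (hsq x)
    · exact Or.inr fun x ↦ mul_nonpos_of_nonpos_of_nonneg
        (mul_nonpos_of_nonpos_of_nonneg (hq x) (hh x).le) (hsq x)
    · exact Or.inl fun x ↦ mul_nonneg (mul_nonneg_of_nonpos_of_nonpos (hq x) (hh x).le) (hsq x)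
  have hcontF : Continuous fun x ↦ P.eval x * expPoly c A B x * w x := by
    unfold expPoly
    fun_prop
  have hzeroF := hcontF.eq_zero_of_integral_eq_zero hint hsign hint0
  obtain ⟨x, hx⟩ := Infinite.exists_notMem_finset (P.roots.toFinset ∪ S)
  rw [Finset.mem_union, not_or, Multiset.mem_toFinset, mem_roots hmonic.ne_zero] at hx
  have := congrFun hzeroF x
  simp only [Pi.zero_apply, mul_eq_zero] at this
  rcases this with (h1 | h1) | h1
  · exact hx.1 h1
  · exact hx.2 ((hiff x).mp h1)
  · exact (Real.exp_pos _).ne' h1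
end

section
/- Let N ≥ 1 be an integer, k = (k₁,k₂) ∈ ℕ², and j ∈ {1,2} with k_j ≥ 1, and write e₁ = (1,0), e₂ = (0,1). Let P^{(N)}_k and P^{(N)}_{k−e_j} be type II multiple orthogonal polynomials for the weights e^{−NV₁}, e^{−NV₂}. Then the zeros of P^{(N)}_k and P^{(N)}_{k−e_j} interlace: writing x₁ < ⋯ < x_{k₁+k₂} for the zeros of P^{(N)}_k and y₁ < ⋯ < y_{k₁+k₂−1} for the zeros of P^{(N)}_{k−e_j} (all zeros being real and simple), one has x_i < y_i < x_{i+1} for every 1 ≤ i ≤ k₁ + k₂ − 1. -/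
open MeasureTheory Polynomial

/-- Rolle's theorem for a finite set of zeros. -/
theorem exists_finset_deriv_eq_zero {f f' : ℝ → ℝ} (hf : ∀ x, HasDerivAt f (f' x) x)
    (s : Finset ℝ) (hs : ∀ x ∈ s, f x = 0) :
    ∃ t : Finset ℝ, (∀ x ∈ t, f' x = 0) ∧ s.card ≤ (t \ s).card + 1 := by
  have hR : ∀ p : ℝ × ℝ, ∃ z, p.1 ∈ s → p.2 ∈ s → p.1 < p.2 →
      p.1 < z ∧ z < p.2 ∧ f' z = 0 := by
    intro p
    by_cases h : p.1 ∈ s ∧ p.2 ∈ s ∧ p.1 < p.2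
    · obtain ⟨z, hz, hz'⟩ := exists_hasDerivAt_eq_zero h.2.2
        (fun x _ => (hf x).continuousAt.continuousWithinAt)
        ((hs _ h.1).trans (hs _ h.2.1).symm) (fun x _ => hf x)
      exact ⟨z, fun _ _ _ => ⟨hz.1, hz.2, hz'⟩⟩
    · exact ⟨0, fun h1 h2 h3 => absurd ⟨h1, h2, h3⟩ h⟩
  choose φ hφ using hR
  refine ⟨((s ×ˢ s).filter fun p => p.1 < p.2).image φ, ?_, ?_⟩
  · intro x hx
    simp only [Finset.mem_image, Finset.mem_filter, Finset.mem_product] at hx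
    obtain ⟨p, ⟨⟨h1, h2⟩, h3⟩, rfl⟩ := hx
    exact (hφ p h1 h2 h3).2.2
  · refine Finset.card_le_sdiff_of_interleaved ?_
    intro x hx y hy hxy _
    obtain ⟨h1, h2, -⟩ := hφ (x, y) hx hy hxy
    refine ⟨φ (x, y), ?_, h1, h2⟩
    exact Finset.mem_image_of_mem _
      (Finset.mem_filter.2 ⟨Finset.mem_product.2 ⟨hx, hy⟩, hxy⟩)

theorem hasDerivAt_add_mul_exp (c : ℝ) (A B : ℝ[X]) (x : ℝ) :
    HasDerivAt (fun x => A.eval x + B.eval x * Real.exp (c * x))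
      ((derivative A).eval x + (derivative B + C c * B).eval x * Real.exp (c * x)) x := by
  have h : HasDerivAt (fun x : ℝ => Real.exp (c * x)) (Real.exp (c * x) * (c * 1)) x :=
    ((hasDerivAt_id x).const_mul c).exp
  refine ((A.hasDerivAt x).add ((B.hasDerivAt x).mul h)).congr_deriv ?_
  simp only [eval_add, eval_mul, eval_C]
  ring

theorem degree_derivative_lt_of_lt_succ {A : ℝ[X]} {n : ℕ} (h : A.degree < (n + 1 : ℕ)) :
    (derivative A).degree < n := by
  by_cases hA : A = 0
  · simp [hA]
  · exact (degree_derivative_lt hA).trans_le (Order.lt_succ_iff.1 (by exact_mod_cast h))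

theorem degree_derivative_add_lt {B : ℝ[X]} {n : ℕ} (c : ℝ) (h : B.degree < n) :
    (derivative B + C c * B).degree < n := by
  refine (degree_add_le _ _).trans_lt (max_lt ?_ ?_)
  · exact (degree_derivative_le).trans_lt h
  · rw [← smul_eq_C_mul]
    exact (degree_smul_le _ _).trans_lt h

theorem derivative_add_ne_zero {B : ℝ[X]} {c : ℝ} (hc : c ≠ 0) (hB : B ≠ 0) :
    derivative B + C c * B ≠ 0 := by
  intro h
  have h1 := degree_derivative_lt hB
  rw [eq_neg_of_add_eq_zero_left h, degree_neg, degree_C_mul hc] at h1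
  exact lt_irrefl _ h1

theorem card_zeros_lt_of_degree_lt {B : ℝ[X]} {n : ℕ} (hB : B ≠ 0) (h : B.degree < n)
    (s : Finset ℝ) (hs : ∀ x ∈ s, B.eval x = 0) : s.card < n := by
  have h1 : s.card ≤ B.roots.toFinset.card :=
    Finset.card_le_card fun x hx => by simpa [hB] using hs x hx
  have h2 := h1.trans ((Multiset.toFinset_card_le _).trans B.card_roots')
  exact h2.trans_lt ((natDegree_lt_iff_degree_lt hB).2 h)

/-- The functions `A + B e^{cx}` form a Chebyshev system. -/
theorem card_zeros_lt {c : ℝ} (hc : c ≠ 0) (k₁ k₂ : ℕ) (A B : ℝ[X])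
    (hA : A.degree < k₁) (hB : B.degree < k₂) (hAB : A ≠ 0 ∨ B ≠ 0)
    (s : Finset ℝ) (hs : ∀ x ∈ s, A.eval x + B.eval x * Real.exp (c * x) = 0) :
    s.card < k₁ + k₂ := by
  induction k₁ generalizing A B s with
  | zero =>
    have hA0 : A = 0 := by simpa using hA
    subst hA0
    rw [zero_add]
    refine card_zeros_lt_of_degree_lt (by simpa using hAB) hB s fun x hx => ?_
    simpa [Real.exp_ne_zero] using hs x hx
  | succ n ih =>
    by_cases h0 : derivative A ≠ 0 ∨ derivative B + C c * B ≠ 0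
    · obtain ⟨t, ht, hst⟩ := exists_finset_deriv_eq_zero (hasDerivAt_add_mul_exp c A B) s hs
      have := ih _ _ (degree_derivative_lt_of_lt_succ hA) (degree_derivative_add_lt c hB) h0 t ht
      have := Finset.card_le_card (Finset.sdiff_subset : t \ s ⊆ t)
      omega
    · push Not at h0
      have hB0 : B = 0 := by
        by_contra h
        exact derivative_add_ne_zero hc h h0.2
      subst hB0
      have := card_zeros_lt_of_degree_lt (by simpa using hAB) hA s
        fun x hx => by simpa using hs x hx
      omega

/-- Zeros of `A + B e^{cx}`, one of them counted twice. -/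
theorem card_zeros_add_one_lt {c : ℝ} (hc : c ≠ 0) (k₁ k₂ : ℕ) (A B : ℝ[X])
    (hA : A.degree < k₁) (hB : B.degree < k₂) (hAB : A ≠ 0 ∨ B ≠ 0)
    (s : Finset ℝ) (hs : ∀ x ∈ s, A.eval x + B.eval x * Real.exp (c * x) = 0)
    {z : ℝ} (hz : z ∈ s)
    (hz' : HasDerivAt (fun x => A.eval x + B.eval x * Real.exp (c * x)) 0 z) :
    s.card + 1 < k₁ + k₂ := by
  have hd := (hasDerivAt_add_mul_exp c A B z).unique hz'
  obtain ⟨t, ht, hst⟩ := exists_finset_deriv_eq_zero (hasDerivAt_add_mul_exp c A B) s hs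
  have key : ∀ n, (∀ u : Finset ℝ, (∀ x ∈ u, (derivative A).eval x +
      (derivative B + C c * B).eval x * Real.exp (c * x) = 0) → u.card < n) → s.card < n := by
    intro n hn
    have hzt : z ∉ t \ s := fun h => (Finset.mem_sdiff.1 h).2 hz
    have := hn (insert z (t \ s)) (by
      intro x hx
      rcases Finset.mem_insert.1 hx with rfl | hx
      · exact hd
      · exact ht x (Finset.mem_sdiff.1 hx).1)
    rw [Finset.card_insert_of_notMem hzt] at this
    omega
  cases k₁ with
  | zero =>
    have hA0 : A = 0 := by simpa using hA
    subst hA0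
    have hB0 : B ≠ 0 := by simpa using hAB
    have hsB : ∀ x ∈ s, B.eval x = 0 := fun x hx => by
      simpa [Real.exp_ne_zero] using hs x hx
    have hdB : (derivative B).eval z = 0 := by
      simpa [Real.exp_ne_zero, hsB z hz] using hd
    have h2 : s.val + {z} ≤ B.roots := by
      classical
      refine Multiset.le_iff_count.2 fun x => ?_
      rw [Multiset.count_add, count_roots]
      by_cases hxz : x = z
      · subst hxz
        have := (one_lt_rootMultiplicity_iff_isRoot hB0).2 ⟨hsB x hz, hdB⟩
        have h3 : s.val.count x ≤ 1 := Multiset.nodup_iff_count_le_one.1 s.nodup x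
        simp only [Multiset.count_singleton_self]
        omega
      · rw [Multiset.count_singleton, if_neg hxz, add_zero]
        by_cases hxs : x ∈ s
        · rw [Multiset.count_eq_one_of_mem s.nodup hxs]
          exact (rootMultiplicity_pos hB0).2 (hsB x hxs)
        · rw [Multiset.count_eq_zero_of_notMem (by simpa using hxs)]
          exact Nat.zero_le _
    have h3 := (Multiset.card_le_card h2).trans B.card_roots'
    have h4 := (natDegree_lt_iff_degree_lt hB0).2 hB
    simp only [Multiset.card_add, Finset.card_val, Multiset.card_singleton] at h3
    omega
  | succ n =>
    by_cases h0 : derivative A ≠ 0 ∨ derivative B + C c * B ≠ 0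
    · have := key _ (card_zeros_lt hc n k₂ _ _ (degree_derivative_lt_of_lt_succ hA)
        (degree_derivative_add_lt c hB) h0)
      omega
    · push Not at h0
      have hB0 : B = 0 := by
        by_contra h
        exact derivative_add_ne_zero hc h h0.2
      subst hB0
      have hA0 : A ≠ 0 := by simpa using hAB
      rw [eq_C_of_derivative_eq_zero h0.1] at hA0 hs
      have := hs z hz
      simp at this hA0
      exact absurd this hA0

theorem exists_ne_zero_forall_eval_eq_zero (c : ℝ) (k₁ k₂ : ℕ) (s : Finset ℝ)
    (hs : s.card < k₁ + k₂) :
    ∃ A B : ℝ[X], A.degree < k₁ ∧ B.degree < k₂ ∧ (A ≠ 0 ∨ B ≠ 0) ∧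
      ∀ x ∈ s, A.eval x + B.eval x * Real.exp (c * x) = 0 := by
  let F : (degreeLT ℝ k₁ × degreeLT ℝ k₂) →ₗ[ℝ] (s → ℝ) :=
    { toFun := fun p x => (p.1 : ℝ[X]).eval (x : ℝ) + (p.2 : ℝ[X]).eval (x : ℝ) * Real.exp (c * x)
      map_add' := by
        intro p q
        ext x
        simp
        ring
      map_smul' := by
        intro r p
        ext x
        simp
        ring }
  have e₁ := degreeLTEquiv ℝ k₁
  have e₂ := degreeLTEquiv ℝ k₂
  have : FiniteDimensional ℝ (degreeLT ℝ k₁) := Module.Finite.equiv e₁.symm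
  have : FiniteDimensional ℝ (degreeLT ℝ k₂) := Module.Finite.equiv e₂.symm
  have hF : LinearMap.ker F ≠ ⊥ := by
    apply LinearMap.ker_ne_bot_of_finrank_lt
    rw [Module.finrank_prod, e₁.finrank_eq, e₂.finrank_eq]
    simpa using hs
  obtain ⟨⟨A, B⟩, hp, hp0⟩ := Submodule.exists_mem_ne_zero_of_ne_bot hF
  refine ⟨A, B, mem_degreeLT.1 A.2, mem_degreeLT.1 B.2, ?_, fun x hx => ?_⟩
  · by_contra! h
    exact hp0 (Prod.ext (Subtype.ext h.1) (Subtype.ext h.2))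
  · exact congrFun (LinearMap.mem_ker.1 hp) ⟨x, hx⟩

theorem hasDerivAt_of_eq_sub_mul {f g : ℝ → ℝ} {z : ℝ} (hg : ContinuousAt g z)
    (hf : ∀ x, f x = (x - z) * g x) : HasDerivAt f (g z) z := by
  rw [hasDerivAt_iff_tendsto_slope]
  refine (hg.tendsto.mono_left nhdsWithin_le_nhds).congr' ?_
  filter_upwards [self_mem_nhdsWithin] with x hx
  have : x - z ≠ 0 := sub_ne_zero.2 hx
  rw [slope_def_field, hf x, hf z]
  field_simp
  ring

theorem exists_continuous_eq_prod_mul (s : Finset ℝ) (f : ℝ → ℝ) (hf : Continuous f)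
    (hd : ∀ z ∈ s, DifferentiableAt ℝ f z) (h0 : ∀ z ∈ s, f z = 0) :
    ∃ g : ℝ → ℝ, Continuous g ∧ ∀ x, f x = (∏ z ∈ s, (x - z)) * g x := by
  classical
  induction s using Finset.induction_on generalizing f with
  | empty => exact ⟨f, hf, by simp⟩
  | insert a s ha ih =>
    have hda := hd a (Finset.mem_insert_self _ _)
    have hfa := h0 a (Finset.mem_insert_self _ _)
    have hne : ∀ z ∈ s, z ≠ a := fun z hz h => ha (h ▸ hz)
    have hmul : ∀ x, (x - a) * dslope f a x = f x := fun x => by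
      simpa using sub_smul_dslope_of_zero hfa x
    have hcont : Continuous (dslope f a) := by
      refine continuous_iff_continuousAt.2 fun x => ?_
      by_cases hx : x = a
      · rw [hx]
        exact continuousAt_dslope_same.2 hda
      · exact (continuousAt_dslope_of_ne hx).2 hf.continuousAt
    obtain ⟨g, hg, hfg⟩ := ih (dslope f a) hcont
      (fun z hz => (differentiableAt_dslope_of_ne (hne z hz)).2
        (hd z (Finset.mem_insert_of_mem hz)))
      (fun z hz => by
        have := hmul z
        rw [h0 z (Finset.mem_insert_of_mem hz)] at this
        exact (mul_eq_zero.1 this).resolve_left (sub_ne_zero.2 (hne z hz)))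
    refine ⟨g, hg, fun x => ?_⟩
    rw [Finset.prod_insert ha, ← hmul x, hfg x, mul_assoc]

theorem nonneg_or_nonpos_of_ne_zero {g : ℝ → ℝ} (hg : Continuous g) (h : ∀ x, g x ≠ 0) :
    (∀ x, 0 ≤ g x) ∨ (∀ x, g x ≤ 0) := by
  by_contra! hc
  obtain ⟨⟨p, hp⟩, q, hq⟩ := hc
  obtain ⟨z, hz⟩ := mem_range_of_exists_le_of_exists_ge hg ⟨p, hp.le⟩ ⟨q, hq.le⟩
  exact h z hz

/-- Splitting off the sign changes of a real polynomial. -/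
theorem exists_eq_prod_mul_of_sign (n : ℕ) (R : ℝ[X]) (hn : R.natDegree ≤ n) (hR : R ≠ 0) :
    ∃ (s : Finset ℝ) (T : ℝ[X]), R = (∏ z ∈ s, (X - C z)) * T ∧ T ≠ 0 ∧
      ((∀ x, 0 ≤ T.eval x) ∨ ∀ x, T.eval x ≤ 0) := by
  classical
  induction n generalizing R with
  | zero =>
    rw [eq_C_of_natDegree_le_zero hn] at hR ⊢
    refine ⟨∅, C (R.coeff 0), by simp, hR, ?_⟩
    simp only [eval_C]
    exact (le_total 0 (R.coeff 0)).imp (fun h _ => h) (fun h _ => h)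
  | succ n ih =>
    by_cases hroot : ∀ x, R.eval x ≠ 0
    · exact ⟨∅, R, by simp, hR, nonneg_or_nonpos_of_ne_zero R.continuous hroot⟩
    push Not at hroot
    obtain ⟨a, ha⟩ := hroot
    obtain ⟨R', hR'⟩ := dvd_iff_isRoot.2 ha
    have hR'0 : R' ≠ 0 := by
      rintro rfl
      exact hR (by simpa using hR')
    have hdeg : R'.natDegree ≤ n := by
      have := natDegree_mul (X_sub_C_ne_zero a) hR'0
      rw [← hR', natDegree_X_sub_C] at this
      omega
    obtain ⟨s, T, hT, hT0, hsign⟩ := ih R' hdeg hR'0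
    by_cases has : a ∈ s
    · refine ⟨s.erase a, (X - C a) ^ 2 * T, ?_, mul_ne_zero (pow_ne_zero _ (X_sub_C_ne_zero a)) hT0, ?_⟩
      · rw [hR', hT, ← Finset.mul_prod_erase s _ has]
        ring
      · simp only [eval_mul, eval_pow]
        exact hsign.imp (fun h x => mul_nonneg (sq_nonneg _) (h x))
          (fun h x => mul_nonpos_of_nonneg_of_nonpos (sq_nonneg _) (h x))
    · refine ⟨insert a s, T, ?_, hT0, hsign⟩
      rw [hR', hT, Finset.prod_insert has, mul_assoc]

open Filter Asymptotics in
theorem integrableOn_Ioi_eval_mul_exp_neg (W p : ℝ[X]) (hW : 2 ≤ W.natDegree)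
    (hlead : 0 < W.leadingCoeff) :
    IntegrableOn (fun x : ℝ => p.eval x * Real.exp (-W.eval x)) (Set.Ioi 0) := by
  refine integrable_of_isBigO_exp_neg one_pos (by fun_prop) ?_
  have hX : (C (2 : ℝ) * X).degree < W.degree := by
    refine lt_of_lt_of_le ?_ (degree_eq_natDegree (leadingCoeff_ne_zero.1 hlead.ne') ▸
      Nat.cast_le.2 hW)
    exact (degree_C_mul_X_le _).trans_lt (by norm_num)
  have hdeg : (W - C 2 * X).degree = W.degree := degree_sub_eq_left_of_degree_lt hX
  have hlc : (W - C 2 * X).leadingCoeff = W.leadingCoeff := leadingCoeff_sub_of_degree_lt hX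
  have htop : Tendsto (fun x => (W - C 2 * X).eval x) atTop atTop := by
    refine tendsto_atTop_of_leadingCoeff_nonneg _ ?_ (hlc ▸ hlead.le)
    rw [hdeg, ← natDegree_pos_iff_degree_pos]
    omega
  have h1 := (p.tendsto_div_exp_atTop).isBigO_one ℝ
  refine IsBigO.trans (g := fun x => Real.exp (-1 * x) * (p.eval x / Real.exp x)) ?_ ?_
  · refine IsBigO.of_bound 1 ?_
    filter_upwards [htop.eventually_ge_atTop 0] with x hx
    simp only [eval_sub, eval_mul, eval_C, eval_X] at hx
    rw [one_mul, norm_mul, div_eq_mul_inv, ← Real.exp_neg, mul_left_comm, norm_mul]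
    refine mul_le_mul_of_nonneg_left ?_ (norm_nonneg _)
    rw [← Real.exp_add, Real.norm_of_nonneg (Real.exp_pos _).le,
      Real.norm_of_nonneg (Real.exp_pos _).le]
    exact Real.exp_le_exp.2 (by linarith)
  · simpa using (isBigO_refl (fun x : ℝ => Real.exp (-1 * x)) atTop).mul h1

theorem integrable_eval_mul_exp_neg (W p : ℝ[X]) (hW : 2 ≤ W.natDegree)
    (heven : Even W.natDegree) (hlead : 0 < W.leadingCoeff) :
    Integrable (fun x : ℝ => p.eval x * Real.exp (-W.eval x)) := by
  have h1 := integrableOn_Ioi_eval_mul_exp_neg W p hW hlead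
  have hc : (W.comp (-X)).leadingCoeff = W.leadingCoeff := by
    rw [leadingCoeff_comp (by simp), leadingCoeff_neg, leadingCoeff_X, heven.neg_one_pow, mul_one]
  have h2 := integrableOn_Ioi_eval_mul_exp_neg (W.comp (-X)) (p.comp (-X))
    (by simpa [natDegree_comp] using hW) (hc ▸ hlead)
  rw [← integrableOn_univ, ← Set.Iic_union_Ioi (a := (0 : ℝ))]
  refine IntegrableOn.union ?_ h1
  rw [integrableOn_Iic_iff_integrableOn_Iio]
  have h3 := IntegrableOn.comp_neg_Iio (c := (0 : ℝ)) (by simpa using h2)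
  simpa using h3

/-- The moment conditions defining type II multiple orthogonality. -/
def MomentsVanish (V : ℝ[X]) (a : ℝ) (N k₁ k₂ : ℕ) (R : ℝ[X]) : Prop :=
  (∀ l < k₁, ∫ x : ℝ, R.eval x * x ^ l * Real.exp (-(N : ℝ) * (V.eval x - a * x)) = 0) ∧
  (∀ l < k₂, ∫ x : ℝ, R.eval x * x ^ l * Real.exp (-(N : ℝ) * (V.eval x + a * x)) = 0)

theorem integrable_eval_mul_exp_weight (V : ℝ[X]) (hVdeg : 2 ≤ V.natDegree)
    (hVeven : Even V.natDegree) (hVlead : 0 < V.leadingCoeff) (b : ℝ) (N : ℕ) (hN : 1 ≤ N)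
    (p : ℝ[X]) :
    Integrable (fun x : ℝ => p.eval x * Real.exp (-(N : ℝ) * (V.eval x + b * x))) := by
  have hN0 : (0 : ℝ) < N := by exact_mod_cast hN
  have hX : (C b * X).degree < V.degree := by
    refine lt_of_lt_of_le ?_ (degree_eq_natDegree (leadingCoeff_ne_zero.1 hVlead.ne') ▸
      Nat.cast_le.2 hVdeg)
    exact (degree_C_mul_X_le _).trans_lt (by norm_num)
  have hdeg : (C (N : ℝ) * (V + C b * X)).natDegree = V.natDegree := by
    rw [natDegree_C_mul hN0.ne', natDegree_add_eq_left_of_degree_lt hX]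
  have hlc : (C (N : ℝ) * (V + C b * X)).leadingCoeff = N * V.leadingCoeff := by
    rw [leadingCoeff_mul, leadingCoeff_C, leadingCoeff_add_of_degree_lt' hX]
  have := integrable_eval_mul_exp_neg (C (N : ℝ) * (V + C b * X)) p (hdeg ▸ hVdeg) (hdeg ▸ hVeven)
    (hlc ▸ mul_pos hN0 hVlead)
  refine this.congr (Filter.Eventually.of_forall fun x => ?_)
  simp

theorem integral_eval_mul_weight_eq_zero {w : ℝ → ℝ}
    (hint : ∀ p : ℝ[X], Integrable fun x => p.eval x * w x) {k : ℕ} {R A : ℝ[X]}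
    (hA : A.degree < k) (h : ∀ l < k, ∫ x : ℝ, R.eval x * x ^ l * w x = 0) :
    ∫ x : ℝ, R.eval x * A.eval x * w x = 0 := by
  have h1 : ∀ x, R.eval x * A.eval x * w x =
      ∑ i ∈ Finset.range (A.natDegree + 1), A.coeff i * (R.eval x * x ^ i * w x) := by
    intro x
    rw [eval_eq_sum_range (p := A), Finset.mul_sum, Finset.sum_mul]
    exact Finset.sum_congr rfl fun i _ => by ring
  simp only [h1]
  rw [integral_finsetSum]
  · refine Finset.sum_eq_zero fun i _ => ?_
    rw [integral_const_mul]
    by_cases hi : i < k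
    · rw [h i hi, mul_zero]
    · rw [coeff_eq_zero_of_degree_lt (hA.trans_le (by exact_mod_cast not_lt.1 hi)), zero_mul]
  · intro i _
    refine Integrable.const_mul ?_ _
    exact (hint (R * X ^ i)).congr (Filter.Eventually.of_forall fun x => by simp)

theorem MomentsVanish.integral_eq_zero {V : ℝ[X]} (hVdeg : 2 ≤ V.natDegree)
    (hVeven : Even V.natDegree) (hVlead : 0 < V.leadingCoeff) {a : ℝ} {N : ℕ} (hN : 1 ≤ N)
    {k₁ k₂ : ℕ} {R A B : ℝ[X]} (hR : MomentsVanish V a N k₁ k₂ R)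
    (hB : B.degree < k₁) (hA : A.degree < k₂) :
    Integrable (fun x : ℝ => R.eval x * (A.eval x + B.eval x * Real.exp (2 * N * a * x)) *
      Real.exp (-(N : ℝ) * (V.eval x + a * x))) ∧
    ∫ x : ℝ, R.eval x * (A.eval x + B.eval x * Real.exp (2 * N * a * x)) *
      Real.exp (-(N : ℝ) * (V.eval x + a * x)) = 0 := by
  have hint₁ : ∀ p : ℝ[X], Integrable
      fun x : ℝ => p.eval x * Real.exp (-(N : ℝ) * (V.eval x - a * x)) := fun p => by
    simpa [sub_eq_add_neg] using
      integrable_eval_mul_exp_weight V hVdeg hVeven hVlead (-a) N hN p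
  have hint₂ := integrable_eval_mul_exp_weight V hVdeg hVeven hVlead a N hN
  have heq : (fun x : ℝ => R.eval x * (A.eval x + B.eval x * Real.exp (2 * N * a * x)) *
      Real.exp (-(N : ℝ) * (V.eval x + a * x))) = fun x =>
      R.eval x * A.eval x * Real.exp (-(N : ℝ) * (V.eval x + a * x)) +
      R.eval x * B.eval x * Real.exp (-(N : ℝ) * (V.eval x - a * x)) := by
    ext x
    have : Real.exp (-(N : ℝ) * (V.eval x - a * x)) =
        Real.exp (2 * N * a * x) * Real.exp (-(N : ℝ) * (V.eval x + a * x)) := by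
      rw [← Real.exp_add]
      ring_nf
    rw [this]
    ring
  have i₁ : Integrable fun x => R.eval x * B.eval x *
      Real.exp (-(N : ℝ) * (V.eval x - a * x)) := by simpa using hint₁ (R * B)
  have i₂ : Integrable fun x => R.eval x * A.eval x *
      Real.exp (-(N : ℝ) * (V.eval x + a * x)) := by simpa using hint₂ (R * A)
  rw [heq]
  refine ⟨i₂.add i₁, ?_⟩
  rw [integral_add i₂ i₁, integral_eval_mul_weight_eq_zero hint₂ hA hR.2,
    integral_eval_mul_weight_eq_zero hint₁ hB hR.1, add_zero]

theorem eq_zero_of_integral_eq_zero_of_sign {f : ℝ → ℝ} (hf : Continuous f)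
    (hi : Integrable f) (h0 : ∫ x, f x = 0) (hs : (∀ x, 0 ≤ f x) ∨ ∀ x, f x ≤ 0) (x : ℝ) :
    f x = 0 := by
  have key : ∀ g : ℝ → ℝ, Continuous g → Integrable g → ∫ x, g x = 0 → (∀ x, 0 ≤ g x) →
      g x = 0 := by
    intro g hg hgi hg0 hpos
    have := (integral_eq_zero_iff_of_nonneg hpos hgi).1 hg0
    exact congrFun ((hg.ae_eq_iff_eq volume continuous_zero).1 this) x
  rcases hs with hs | hs
  · exact key f hf hi h0 hs
  · exact neg_eq_zero.1 (key (fun x => -f x) hf.neg hi.neg (by rw [integral_neg, h0, neg_zero])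
      fun x => neg_nonneg.2 (hs x))

/-- A polynomial satisfying the moment conditions has at least `k₁ + k₂` sign changes. -/
theorem MomentsVanish.le_card {V : ℝ[X]} (hVdeg : 2 ≤ V.natDegree)
    (hVeven : Even V.natDegree) (hVlead : 0 < V.leadingCoeff) {a : ℝ} (ha : 0 < a) {N : ℕ}
    (hN : 1 ≤ N) {k₁ k₂ : ℕ} {R T : ℝ[X]} (hR : MomentsVanish V a N k₁ k₂ R) (s : Finset ℝ)
    (hRT : R = (∏ z ∈ s, (X - C z)) * T) (hT : T ≠ 0)
    (hsign : (∀ x, 0 ≤ T.eval x) ∨ ∀ x, T.eval x ≤ 0) : k₁ + k₂ ≤ s.card := by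
  classical
  by_contra! hlt
  obtain ⟨m₁, m₂, hm₁, hm₂, hm⟩ : ∃ m₁ m₂, m₁ ≤ k₁ ∧ m₂ ≤ k₂ ∧ m₂ + m₁ = s.card + 1 :=
    ⟨min k₁ (s.card + 1), s.card + 1 - min k₁ (s.card + 1), by omega, by omega, by omega⟩
  have hN0 : (0 : ℝ) < N := by exact_mod_cast hN
  have hc : (2 * N * a : ℝ) ≠ 0 := by positivity
  obtain ⟨A, B, hA, hB, hAB, hs⟩ :=
    exists_ne_zero_forall_eval_eq_zero (2 * N * a) m₂ m₁ s (by omega)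
  set f : ℝ → ℝ := fun x => A.eval x + B.eval x * Real.exp (2 * N * a * x) with hfdef
  have hfd : ∀ x, DifferentiableAt ℝ f x := fun x =>
    (hasDerivAt_add_mul_exp _ A B x).differentiableAt
  have hfc : Continuous f := by fun_prop
  obtain ⟨g, hg, hfg⟩ := exists_continuous_eq_prod_mul s f hfc (fun z _ => hfd z) hs
  have hg0 : ∀ x, g x ≠ 0 := by
    intro z hz
    by_cases hzs : z ∈ s
    · have hd : HasDerivAt f ((∏ y ∈ s.erase z, (z - y)) * g z) z := by
        refine hasDerivAt_of_eq_sub_mul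
          (g := fun x => (∏ y ∈ s.erase z, (x - y)) * g x) (by fun_prop) fun x => ?_
        rw [hfg x, ← Finset.mul_prod_erase s _ hzs, mul_assoc]
      rw [hz, mul_zero] at hd
      have := card_zeros_add_one_lt hc m₂ m₁ A B hA hB hAB s hs hzs hd
      omega
    · have := card_zeros_lt hc m₂ m₁ A B hA hB hAB (insert z s) (by
        intro x hx
        rcases Finset.mem_insert.1 hx with rfl | hx
        · simpa [hz] using hfg x
        · exact hs x hx)
      rw [Finset.card_insert_of_notMem hzs] at this
      omega
  obtain ⟨hi, h0⟩ := hR.integral_eq_zero hVdeg hVeven hVlead hN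
    (hB.trans_le (by exact_mod_cast hm₁)) (hA.trans_le (by exact_mod_cast hm₂))
  have hform : ∀ x, R.eval x * (A.eval x + B.eval x * Real.exp (2 * N * a * x)) *
      Real.exp (-(N : ℝ) * (V.eval x + a * x)) =
      ((∏ z ∈ s, (x - z)) ^ 2 * Real.exp (-(N : ℝ) * (V.eval x + a * x))) *
        (T.eval x * g x) := by
    intro x
    have h1 := hfg x
    simp only [hfdef] at h1
    rw [h1, hRT]
    simp only [eval_mul, eval_prod, eval_sub, eval_X, eval_C]
    ring
  have hsign' : (∀ x, 0 ≤ T.eval x * g x) ∨ ∀ x, T.eval x * g x ≤ 0 := by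
    rcases hsign with h1 | h1 <;> rcases nonneg_or_nonpos_of_ne_zero hg hg0 with h2 | h2
    · exact .inl fun x => mul_nonneg (h1 x) (h2 x)
    · exact .inr fun x => mul_nonpos_of_nonneg_of_nonpos (h1 x) (h2 x)
    · exact .inr fun x => mul_nonpos_of_nonpos_of_nonneg (h1 x) (h2 x)
    · exact .inl fun x => mul_nonneg_of_nonpos_of_nonpos (h1 x) (h2 x)
  have hw : ∀ x : ℝ, 0 ≤ (∏ z ∈ s, (x - z)) ^ 2 *
      Real.exp (-(N : ℝ) * (V.eval x + a * x)) := fun x => by positivity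
  have hzero := eq_zero_of_integral_eq_zero_of_sign (by fun_prop) hi h0 (by
    simp only [hform]
    exact hsign'.imp (fun h x => mul_nonneg (hw x) (h x))
      (fun h x => mul_nonpos_of_nonneg_of_nonpos (hw x) (h x)))
  have hS : (∏ z ∈ s, (X - C z)) ≠ 0 := Finset.prod_ne_zero_iff.2 fun z _ => X_sub_C_ne_zero z
  refine mul_ne_zero (pow_ne_zero 2 hS) hT (Polynomial.funext fun x => ?_)
  have := hzero x
  rw [hform] at this
  simpa [eval_prod, hg0 x, Real.exp_ne_zero, Finset.prod_eq_zero_iff, or_assoc] using this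

theorem MomentsVanish.exists_eq_prod {V : ℝ[X]} (hVdeg : 2 ≤ V.natDegree)
    (hVeven : Even V.natDegree) (hVlead : 0 < V.leadingCoeff) {a : ℝ} (ha : 0 < a) {N : ℕ}
    (hN : 1 ≤ N) {k₁ k₂ : ℕ} {R : ℝ[X]} (hR : MomentsVanish V a N k₁ k₂ R) (hR0 : R ≠ 0)
    (hdeg : R.natDegree ≤ k₁ + k₂ + 1) :
    ∃ (s : Finset ℝ) (c : ℝ), c ≠ 0 ∧ R = (∏ z ∈ s, (X - C z)) * C c := by
  obtain ⟨s, T, hRT, hT, hsign⟩ := exists_eq_prod_mul_of_sign _ R le_rfl hR0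
  have hle := hR.le_card hVdeg hVeven hVlead ha hN s hRT hT hsign
  have hS : (∏ z ∈ s, (X - C z)) ≠ 0 := Finset.prod_ne_zero_iff.2 fun z _ => X_sub_C_ne_zero z
  have hd : R.natDegree = s.card + T.natDegree := by
    rw [hRT, natDegree_mul hS hT, natDegree_finsetProd_X_sub_C_eq_card]
  have hT1 : T.natDegree ≤ 1 := by omega
  obtain ⟨c, d, rfl⟩ := exists_eq_X_add_C_of_natDegree_le_one hT1
  have hc : c = 0 := by
    by_contra hc
    have e1 : (C c * X + C d).eval ((1 - d) / c) = 1 := by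
      simp
      field_simp
      ring
    have e2 : (C c * X + C d).eval ((-1 - d) / c) = -1 := by
      simp
      field_simp
      ring
    rcases hsign with h | h
    · have := h ((-1 - d) / c)
      rw [e2] at this
      linarith
    · have := h ((1 - d) / c)
      rw [e1] at this
      linarith
  subst hc
  refine ⟨s, d, ?_, by simpa using hRT⟩
  rintro rfl
  simp at hT

theorem eval_derivative_ne_zero_of_eq_prod {R : ℝ[X]} {s : Finset ℝ} {c : ℝ} (hc : c ≠ 0)
    (hR : R = (∏ z ∈ s, (X - C z)) * C c) (x : ℝ) (hx : R.eval x = 0) :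
    (derivative R).eval x ≠ 0 := by
  classical
  have hxs : x ∈ s := by
    simpa [hR, eval_prod, Finset.prod_eq_zero_iff, hc, sub_eq_zero] using hx
  rw [hR, ← Finset.mul_prod_erase s _ hxs]
  simp [eval_prod, Finset.prod_eq_zero_iff, hc, sub_eq_zero]

/-- Zeros interlace when no nontrivial combination has a double zero: a zero of `Q` lies strictly
between any two zeros of `P`. -/
theorem exists_root_between {P Q : ℝ[X]}
    (h : ∀ x, (derivative P).eval x * Q.eval x - P.eval x * (derivative Q).eval x ≠ 0)
    {u v : ℝ} (huv : u < v) (hu : P.eval u = 0) (hv : P.eval v = 0) :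
    ∃ y, u < y ∧ y < v ∧ Q.eval y = 0 := by
  by_contra! hno
  have hQ : ∀ y ∈ Set.Icc u v, Q.eval y ≠ 0 := by
    intro y hy hy0
    rcases eq_or_lt_of_le hy.1 with rfl | h1
    · exact h u (by simp [hu, hy0])
    rcases eq_or_lt_of_le hy.2 with rfl | h2
    · exact h y (by simp [hv, hy0])
    exact hno y h1 h2 hy0
  obtain ⟨z, hz, hz0⟩ := exists_hasDerivAt_eq_zero (f := fun x => P.eval x / Q.eval x) huv
    (P.continuous.continuousOn.div Q.continuous.continuousOn hQ) (by simp [hu, hv])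
    (fun x hx => (P.hasDerivAt x).div (Q.hasDerivAt x) (hQ x (Set.Ioo_subset_Icc_self hx)))
  exact (div_ne_zero (h z) (pow_ne_zero 2 (hQ z (Set.Ioo_subset_Icc_self hz)))) hz0

theorem MomentsVanish.mono {V : ℝ[X]} {a : ℝ} {N k₁ k₂ l₁ l₂ : ℕ} {R : ℝ[X]}
    (hR : MomentsVanish V a N k₁ k₂ R) (h₁ : l₁ ≤ k₁) (h₂ : l₂ ≤ k₂) :
    MomentsVanish V a N l₁ l₂ R :=
  ⟨fun l hl => hR.1 l (hl.trans_le h₁), fun l hl => hR.2 l (hl.trans_le h₂)⟩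

theorem MomentsVanish.combination {V : ℝ[X]} (hVdeg : 2 ≤ V.natDegree)
    (hVeven : Even V.natDegree) (hVlead : 0 < V.leadingCoeff) {a : ℝ} {N : ℕ}
    (hN : 1 ≤ N) {k₁ k₂ : ℕ} {P Q : ℝ[X]} (hP : MomentsVanish V a N k₁ k₂ P)
    (hQ : MomentsVanish V a N k₁ k₂ Q) (α β : ℝ) :
    MomentsVanish V a N k₁ k₂ (C α * P + C β * Q) := by
  have key : ∀ (b : ℝ) (l : ℕ),
      ∫ x : ℝ, P.eval x * x ^ l * Real.exp (-(N : ℝ) * (V.eval x + b * x)) = 0 →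
      ∫ x : ℝ, Q.eval x * x ^ l * Real.exp (-(N : ℝ) * (V.eval x + b * x)) = 0 →
      ∫ x : ℝ, (C α * P + C β * Q).eval x * x ^ l *
        Real.exp (-(N : ℝ) * (V.eval x + b * x)) = 0 := by
    intro b l h1 h2
    have hi : ∀ R : ℝ[X], Integrable fun x : ℝ => R.eval x * x ^ l *
        Real.exp (-(N : ℝ) * (V.eval x + b * x)) := fun R =>
      (integrable_eval_mul_exp_weight V hVdeg hVeven hVlead b N hN (R * X ^ l)).congr
        (Filter.Eventually.of_forall fun x => by simp)
    have he : ∀ x : ℝ, (C α * P + C β * Q).eval x * x ^ l *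
        Real.exp (-(N : ℝ) * (V.eval x + b * x)) =
        α * (P.eval x * x ^ l * Real.exp (-(N : ℝ) * (V.eval x + b * x))) +
        β * (Q.eval x * x ^ l * Real.exp (-(N : ℝ) * (V.eval x + b * x))) := fun x => by
      simp only [eval_add, eval_mul, eval_C]
      ring
    simp only [he]
    rw [integral_add ((hi P).const_mul α) ((hi Q).const_mul β), integral_const_mul,
      integral_const_mul, h1, h2]
    simp
  refine ⟨fun l hl => ?_, fun l hl => key a l (hP.2 l hl) (hQ.2 l hl)⟩
  have := key (-a) l (by simpa [sub_eq_add_neg] using hP.1 l hl)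
    (by simpa [sub_eq_add_neg] using hQ.1 l hl)
  simpa only [neg_mul a, ← sub_eq_add_neg] using this

/-- **Interlacing of zeros** of `P^{(N)}_k` and `P^{(N)}_{k−e_j}`: there are strictly
increasing enumerations `x` (of the `k₁+k₂` zeros of `P`) and `y` (of the `k₁+k₂−1`
zeros of `Q = P^{(N)}_{k−e_j}`), and `x i < y i < x (i+1)`. -/
theorem stmt2 (V : Polynomial ℝ) (hVdeg : 2 ≤ V.natDegree) (hVeven : Even V.natDegree)
    (hVlead : 0 < V.leadingCoeff) (hV0 : V.coeff 0 = 0)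
    (a : ℝ) (ha : 0 < a) (N : ℕ) (hN : 1 ≤ N)
    (k₁ k₂ l₁ l₂ : ℕ)
    (hsub : (l₁ + 1 = k₁ ∧ l₂ = k₂) ∨ (l₁ = k₁ ∧ l₂ + 1 = k₂))
    (P Q : Polynomial ℝ)
    (hP : IsTypeIIMOP V a N k₁ k₂ P) (hQ : IsTypeIIMOP V a N l₁ l₂ Q) :
    ∃ (x y : ℕ → ℝ),
      (∀ i j : ℕ, i < j → j < k₁ + k₂ → x i < x j) ∧
      (∀ z : ℝ, P.eval z = 0 ↔ ∃ i < k₁ + k₂, z = x i) ∧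
      (∀ i j : ℕ, i < j → j < k₁ + k₂ - 1 → y i < y j) ∧
      (∀ z : ℝ, Q.eval z = 0 ↔ ∃ i < k₁ + k₂ - 1, z = y i) ∧
      (∀ i : ℕ, i + 1 < k₁ + k₂ → x i < y i ∧ y i < x (i + 1)) := by
  have hPm : MomentsVanish V a N k₁ k₂ P := hP.2.2
  have hQm : MomentsVanish V a N l₁ l₂ Q := hQ.2.2
  have hPdeg : P.natDegree = k₁ + k₂ := hP.2.1
  have hQdeg : Q.natDegree = l₁ + l₂ := hQ.2.1
  have hP0 : P ≠ 0 := hP.1.ne_zero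
  have hQ0 : Q ≠ 0 := hQ.1.ne_zero
  have hkl : k₁ + k₂ = l₁ + l₂ + 1 := by omega
  have hPm' : MomentsVanish V a N l₁ l₂ P := hPm.mono (by omega) (by omega)
  have hW : ∀ x, (derivative P).eval x * Q.eval x - P.eval x * (derivative Q).eval x ≠ 0 := by
    intro x hx
    have key : ∀ α β : ℝ, (α ≠ 0 ∨ β ≠ 0) → α * P.eval x + β * Q.eval x = 0 →
        α * (derivative P).eval x + β * (derivative Q).eval x = 0 → False := by
      intro α β hαβ h1 h2
      have hne : C α * P + C β * Q ≠ 0 := by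
        intro h
        have hα : α = 0 := by
          have h3 := congrArg (fun p => p.coeff (k₁ + k₂)) h
          have h4 : P.coeff (k₁ + k₂) = 1 := hPdeg ▸ hP.1.coeff_natDegree
          have h5 : Q.coeff (k₁ + k₂) = 0 := coeff_eq_zero_of_natDegree_lt (by omega)
          simpa [h4, h5] using h3
        have hβ : β ≠ 0 := hαβ.resolve_left (not_not.2 hα)
        simp [hα, hβ, hQ0] at h
      have hd : (C α * P + C β * Q).natDegree ≤ l₁ + l₂ + 1 := by
        refine natDegree_add_le_of_degree_le ?_ ?_
        · exact (natDegree_C_mul_le _ _).trans (by omega)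
        · exact (natDegree_C_mul_le _ _).trans (by omega)
      obtain ⟨s, c, hc, hs⟩ := (hPm'.combination hVdeg hVeven hVlead hN hQm α β).exists_eq_prod
        hVdeg hVeven hVlead ha hN hne hd
      exact eval_derivative_ne_zero_of_eq_prod hc hs x (by simpa using h1) (by simpa using h2)
    by_cases h0 : Q.eval x = 0 ∧ P.eval x = 0
    · by_cases h1 : (derivative Q).eval x = 0
      · exact key 0 1 (by simp) (by simp [h0.1]) (by simp [h1])
      · exact key ((derivative Q).eval x) (-(derivative P).eval x) (.inl h1)
          (by simp [h0.1, h0.2]) (by ring)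
    · refine key (Q.eval x) (-P.eval x) ?_ (by ring) (by linarith)
      by_contra! h
      exact h0 ⟨h.1, neg_eq_zero.1 h.2⟩
  obtain ⟨s, c, hc, hs⟩ := hPm.exists_eq_prod hVdeg hVeven hVlead ha hN hP0 (by omega)
  have hcard : s.card = k₁ + k₂ := by
    rw [← hPdeg, hs, natDegree_mul_C hc, natDegree_finsetProd_X_sub_C_eq_card]
  have hroots : ∀ z, P.eval z = 0 ↔ z ∈ s := by
    intro z
    simp [hs, eval_prod, Finset.prod_eq_zero_iff, hc, sub_eq_zero]
  let x : ℕ → ℝ := fun i => if h : i < k₁ + k₂ then s.orderEmbOfFin hcard ⟨i, h⟩ else 0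
  have hxe : ∀ i (h : i < k₁ + k₂), x i = s.orderEmbOfFin hcard ⟨i, h⟩ := fun i h => dif_pos h
  have hx : ∀ i j : ℕ, i < j → j < k₁ + k₂ → x i < x j := by
    intro i j hij hj
    rw [hxe i (hij.trans hj), hxe j hj]
    exact (s.orderEmbOfFin hcard).strictMono hij
  have hxP : ∀ z, P.eval z = 0 ↔ ∃ i < k₁ + k₂, z = x i := by
    intro z
    rw [hroots, ← Finset.mem_coe, ← Finset.range_orderEmbOfFin s hcard]
    constructor
    · rintro ⟨i, rfl⟩
      exact ⟨i, i.2, (hxe i i.2).symm⟩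
    · rintro ⟨i, hi, rfl⟩
      exact ⟨⟨i, hi⟩, (hxe i hi).symm⟩
  have hy : ∀ i, ∃ y, i + 1 < k₁ + k₂ → x i < y ∧ y < x (i + 1) ∧ Q.eval y = 0 := by
    intro i
    by_cases hi : i + 1 < k₁ + k₂
    · obtain ⟨y, h⟩ := exists_root_between hW (hx i (i + 1) (Nat.lt_succ_self i) hi)
        ((hxP _).2 ⟨i, by omega, rfl⟩) ((hxP _).2 ⟨i + 1, hi, rfl⟩)
      exact ⟨y, fun _ => h⟩
    · exact ⟨0, fun h => absurd h hi⟩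
  choose y hy using hy
  have hymono : ∀ i j : ℕ, i < j → j < k₁ + k₂ - 1 → y i < y j := by
    intro i j hij hj
    have h1 := (hy i (by omega)).2.1
    have h2 := (hy j (by omega)).1
    rcases eq_or_lt_of_le (Nat.succ_le_of_lt hij) with h | h
    · subst h
      exact h1.trans h2
    · exact (h1.trans (hx (i + 1) j h (by omega))).trans h2
  refine ⟨x, y, hx, hxP, hymono, fun z => ⟨fun hz => ?_, ?_⟩, fun i hi =>
    ⟨(hy i hi).1, (hy i hi).2.1⟩⟩
  · have hinj : Set.InjOn y (Finset.range (k₁ + k₂ - 1)) := by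
      intro i hi j hj hij
      simp only [Finset.coe_range, Set.mem_Iio] at hi hj
      rcases lt_trichotomy i j with h | h | h
      · exact absurd hij (hymono i j h hj).ne
      · exact h
      · exact absurd hij (hymono j i h hi).ne'
    have hsub' : (Finset.range (k₁ + k₂ - 1)).image y ⊆ Q.roots.toFinset := by
      intro w hw
      obtain ⟨i, hi, rfl⟩ := Finset.mem_image.1 hw
      have := Finset.mem_range.1 hi
      simpa [hQ0] using (hy i (by omega)).2.2
    have heq := Finset.eq_of_subset_of_card_le hsub' (by
      rw [Finset.card_image_of_injOn hinj, Finset.card_range]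
      exact (Multiset.toFinset_card_le _).trans (Q.card_roots'.trans (by omega)))
    have hzr : z ∈ Q.roots.toFinset := by simpa [hQ0] using hz
    rw [← heq] at hzr
    obtain ⟨i, hi, rfl⟩ := Finset.mem_image.1 hzr
    exact ⟨i, Finset.mem_range.1 hi, rfl⟩
  · rintro ⟨i, hi, rfl⟩
    exact (hy i (by omega)).2.2
end

section
/- Let (n_k) be an up-right path with parameter d, and let (P_k)_{k∈ℕ²} be a family of real polynomials satisfying the type II nearest-neighbor recurrence relations with real coefficients a^{(1)}_k, a^{(2)}_k, b^{(1)}_k, b^{(2)}_k. Then for every k ≥ 2d there exist real numbers θ^{(0)}_k, …, θ^{(d)}_k such that x·P_{n_k}(x) = P_{n_{k+1}}(x) + ∑_{ℓ=0}^{d} θ^{(ℓ)}_k P_{n_{k−ℓ}}(x) identically in x. Moreover, the θ^{(ℓ)}_k can be chosen so that |θ^{(ℓ)}_k| ≤ 2B(2B)^d whenever B ≥ 1 satisfies |a^{(i)}_m| ≤ B and |b^{(i)}_m| ≤ B for i = 1,2 and every multi-index m with m ≤ n_{k+1} componentwise and m₁ + m₂ ≥ k − d − 2. -/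
open Polynomial

/-- The unit multi-indices `e₁ = (1,0)` and `e₂ = (0,1)`, indexed by `Fin 2`. -/
def euv : Fin 2 → ℕ × ℕ := fun j => if j = 0 then (1, 0) else (0, 1)

/-- Componentwise sum of multi-indices. -/
def addIdx (k v : ℕ × ℕ) : ℕ × ℕ := (k.1 + v.1, k.2 + v.2)

/-- Componentwise (truncated) difference of multi-indices. -/
def subIdx (k v : ℕ × ℕ) : ℕ × ℕ := (k.1 - v.1, k.2 - v.2)

/-- An up-right path with parameter `d ≥ 2`. -/
def IsUpRightPath (d : ℕ) (n : ℕ → ℕ × ℕ) : Prop :=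
  (∀ k, (n k).1 + (n k).2 = k) ∧
  (∀ k, n (k + 1) = addIdx (n k) (euv 0) ∨ n (k + 1) = addIdx (n k) (euv 1)) ∧
  (∀ k, (n k).1 + 1 ≤ (n (k + d)).1 ∧ (n k).2 + 1 ≤ (n (k + d)).2)

/-- Type II nearest-neighbor recurrence relations with coefficients
`a j k = a^{(j+1)}_k`, `b j k = b^{(j+1)}_k`. -/
def NNRecurrenceII (P : ℕ × ℕ → Polynomial ℝ) (a b : Fin 2 → ℕ × ℕ → ℝ) : Prop :=
  ∀ k : ℕ × ℕ, 1 ≤ k.1 → 1 ≤ k.2 → ∀ j : Fin 2,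
    Polynomial.X * P k = P (addIdx k (euv j)) + Polynomial.C (b j k) * P k
      + Polynomial.C (a 0 k) * P (subIdx k (euv 0))
      + Polynomial.C (a 1 k) * P (subIdx k (euv 1))

/-- The `j`-th component of a multi-index. -/
def coord (j : Fin 2) (m : ℕ × ℕ) : ℕ := if j = 0 then m.1 else m.2

theorem eq_sum_prod_of_step {R : Type*} [CommSemiring R] {F G γ : ℕ → R} {s : ℕ}
    (hstep : ∀ i < s, F i = G i + γ i * F (i + 1)) (hend : F s = G s) :
    F 0 = ∑ l ∈ Finset.range (s + 1), (∏ i ∈ Finset.range l, γ i) * G l := by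
  have partial_sum : ∀ t ≤ s, F 0 = ∑ l ∈ Finset.range t, (∏ i ∈ Finset.range l, γ i) * G l
      + (∏ i ∈ Finset.range t, γ i) * F t := by
    intro t
    induction t with
    | zero => simp
    | succ t ih =>
      intro ht
      rw [ih (by omega), hstep t (by omega), Finset.sum_range_succ, Finset.prod_range_succ]
      ring
  rw [partial_sum s le_rfl, Finset.sum_range_succ, hend]

theorem IsUpRightPath.mono {d : ℕ} {n : ℕ → ℕ × ℕ} (h : IsUpRightPath d n) : Monotone n := by
  refine monotone_nat_of_le_succ fun k => ?_
  rcases h.2.1 k with h | h <;> rw [h] <;> simp [addIdx, Prod.le_def]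

theorem IsUpRightPath.one_le {d : ℕ} {n : ℕ → ℕ × ℕ} (h : IsUpRightPath d n) {k : ℕ}
    (hk : d ≤ k) : 1 ≤ (n k).1 ∧ 1 ≤ (n k).2 := by
  have := h.2.2 (k - d)
  rw [Nat.sub_add_cancel hk] at this
  omega

theorem IsUpRightPath.succ_eq_or {d : ℕ} {n : ℕ → ℕ × ℕ} (h : IsUpRightPath d n) (j : Fin 2)
    (k : ℕ) : n (k + 1) = addIdx (n k) (euv j) ∨ n (k + 1) = addIdx (n k) (euv (1 - j)) := by
  have := h.2.1 k
  fin_cases j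
  · exact this
  · exact this.symm

theorem NNRecurrenceII.eq_add {P : ℕ × ℕ → Polynomial ℝ} {a b : Fin 2 → ℕ × ℕ → ℝ}
    (hrec : NNRecurrenceII P a b) {m : ℕ × ℕ} (h1 : 1 ≤ m.1) (h2 : 1 ≤ m.2) (i j : Fin 2) :
    P (addIdx m (euv i)) = P (addIdx m (euv j)) + C (b j m - b i m) * P m := by
  have hi := hrec m h1 h2 i
  have hj := hrec m h1 h2 j
  rw [C_sub]
  linear_combination hj - hi

/-- Expansion of a lower neighbor of a point of the path along the path. -/
theorem NNRecurrenceII.exists_expansion {d : ℕ} {n : ℕ → ℕ × ℕ} (hpath : IsUpRightPath d n)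
    {P : ℕ × ℕ → Polynomial ℝ} {a b : Fin 2 → ℕ × ℕ → ℝ}
    (hrec : NNRecurrenceII P a b) {k : ℕ} (hd : 1 ≤ d) (hk : 2 * d ≤ k) (j : Fin 2) :
    ∃ θ : ℕ → ℝ,
      P (subIdx (n k) (euv j)) = ∑ l ∈ Finset.range d, C (θ l) * P (n (k - (l + 1))) ∧
      ∀ B : ℝ, 1 ≤ B →
        (∀ m : ℕ × ℕ, m ≤ n k → k - d - 2 ≤ m.1 + m.2 → ∀ i : Fin 2, |b i m| ≤ B) →
        ∀ l, |θ l| ≤ (2 * B) ^ l := by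
  have hcoord : coord j (n (k - d)) + 1 ≤ coord j (n k) := by
    have := hpath.2.2 (k - d)
    rw [Nat.sub_add_cancel (by omega)] at this
    unfold coord
    split_ifs <;> omega
  have hconst : ∀ t ≤ d, (∀ i < t, n (k - i) ≠ addIdx (n (k - (i + 1))) (euv j)) →
      coord j (n (k - t)) = coord j (n k) := by
    intro t
    induction t with
    | zero => simp
    | succ t ih =>
      intro ht hne
      rw [← ih (by omega) fun i hi => hne i (by omega)]
      have hstep := hpath.succ_eq_or j (k - (t + 1))
      rw [show k - (t + 1) + 1 = k - t by omega] at hstep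
      rw [hstep.resolve_left (hne t (by omega))]
      fin_cases j <;> simp [coord, addIdx, euv]
  have hex : ∃ s, s < d ∧ n (k - s) = addIdx (n (k - (s + 1))) (euv j) := by
    by_contra! hne
    have := hconst d le_rfl hne
    omega
  classical
  let s := Nat.find hex
  obtain ⟨hsd, hs⟩ : s < d ∧ n (k - s) = addIdx (n (k - (s + 1))) (euv j) := Nat.find_spec hex
  have hmin : ∀ i < s, n (k - i) ≠ addIdx (n (k - (i + 1))) (euv j) := fun i hi h =>
    Nat.find_min hex hi ⟨by omega, h⟩
  let m : ℕ → ℕ × ℕ := fun i => subIdx (n (k - (i + 1))) (euv j)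
  let γ : ℕ → ℝ := fun i => b j (m i) - b (1 - j) (m i)
  have hstep : ∀ i < s, P (subIdx (n (k - i)) (euv j)) = P (n (k - (i + 1)))
      + C (γ i) * P (subIdx (n (k - (i + 1))) (euv j)) := by
    intro i hi
    have hc := hconst (i + 1) (by omega) fun i' hi' => hmin i' (by omega)
    have hpos := hpath.one_le (k := k - (i + 1)) (by omega)
    have hpos' := hpath.one_le (k := k - d) (by omega)
    have hn := hpath.succ_eq_or j (k - (i + 1))
    rw [show k - (i + 1) + 1 = k - i by omega] at hn
    replace hn := hn.resolve_left (hmin i hi)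
    have hm : 1 ≤ (m i).1 ∧ 1 ≤ (m i).2 := by
      fin_cases j <;> simp [coord, m, subIdx, euv] at * <;> omega
    have hmj : addIdx (m i) (euv j) = n (k - (i + 1)) := by
      ext <;> fin_cases j <;> simp [m, subIdx, addIdx, euv] <;> omega
    have hmi : addIdx (m i) (euv (1 - j)) = subIdx (n (k - i)) (euv j) := by
      rw [hn]
      ext <;> fin_cases j <;> simp [m, subIdx, addIdx, euv]
    rw [← hmi, hrec.eq_add hm.1 hm.2 (1 - j) j, hmj]
  have hend : P (subIdx (n (k - s)) (euv j)) = P (n (k - (s + 1))) := by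
    rw [hs]
    simp [addIdx, subIdx]
  refine ⟨fun l => if l ≤ s then ∏ i ∈ Finset.range l, γ i else 0, ?_, ?_⟩
  · have hsum := eq_sum_prod_of_step (F := fun i => P (subIdx (n (k - i)) (euv j)))
      (G := fun i => P (n (k - (i + 1)))) (γ := fun i => C (γ i)) hstep hend
    simp only [Nat.sub_zero] at hsum
    rw [hsum]
    refine Finset.sum_subset_zero_on_sdiff (Finset.range_mono (by omega)) ?_ ?_
    · intro l hl
      simp only [Finset.mem_sdiff, Finset.mem_range] at hl
      simp only [if_neg (show ¬l ≤ s by omega), C_0, zero_mul]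
    · intro l hl
      rw [Finset.mem_range] at hl
      simp only [if_pos (show l ≤ s by omega), map_prod]
  · intro B hB hb l
    dsimp only
    split_ifs with hl
    · rw [Finset.abs_prod]
      refine (Finset.prod_le_prod (g := fun _ => 2 * B) (fun _ _ => abs_nonneg _)
        fun i hi => ?_).trans_eq (by simp)
      rw [Finset.mem_range] at hi
      have hle : m i ≤ n k := by
        refine le_trans ?_ (hpath.mono (show k - (i + 1) ≤ k by omega))
        simp [m, subIdx, Prod.le_def]
      have hsum : k - d - 2 ≤ (m i).1 + (m i).2 := by
        have := hpath.1 (k - (i + 1))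
        fin_cases j <;> simp [m, subIdx, euv] <;> omega
      have h1 := hb _ hle hsum j
      have h2 := hb _ hle hsum (1 - j)
      rw [abs_le] at h1 h2 ⊢
      constructor <;> simp only [γ] <;> linarith
    · simp only [abs_zero]
      positivity

/-- **`d`-term recurrence along an up-right path**, with the explicit bound
`|θ^{(ℓ)}_k| ≤ 2B(2B)^d` whenever `B ≥ 1` bounds the nearest-neighbor recurrence
coefficients for the relevant multi-indices. -/
theorem stmt4 (d : ℕ) (hd : 2 ≤ d) (n : ℕ → ℕ × ℕ) (hpath : IsUpRightPath d n)
    (P : ℕ × ℕ → Polynomial ℝ) (a b : Fin 2 → ℕ × ℕ → ℝ)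
    (hrec : NNRecurrenceII P a b) (k : ℕ) (hk : 2 * d ≤ k) :
    ∃ θ : ℕ → ℝ,
      (Polynomial.X * P (n k) = P (n (k + 1))
        + ∑ l ∈ Finset.range (d + 1), Polynomial.C (θ l) * P (n (k - l))) ∧
      ∀ B : ℝ, 1 ≤ B →
        (∀ m : ℕ × ℕ, m.1 ≤ (n (k + 1)).1 → m.2 ≤ (n (k + 1)).2 →
          k - d - 2 ≤ m.1 + m.2 → ∀ j : Fin 2, |a j m| ≤ B ∧ |b j m| ≤ B) →
        ∀ l ≤ d, |θ l| ≤ 2 * B * (2 * B) ^ d := by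
  obtain ⟨θ₀, h₀, hB₀⟩ := hrec.exists_expansion hpath (by omega) hk 0
  obtain ⟨θ₁, h₁, hB₁⟩ := hrec.exists_expansion hpath (by omega) hk 1
  obtain ⟨j, hj⟩ : ∃ j, n (k + 1) = addIdx (n k) (euv j) :=
    (hpath.2.1 k).elim (fun h => ⟨0, h⟩) fun h => ⟨1, h⟩
  have hpos := hpath.one_le (k := k) (by omega)
  refine ⟨fun l => l.casesOn (b j (n k)) fun l => a 0 (n k) * θ₀ l + a 1 (n k) * θ₁ l, ?_, ?_⟩
  · rw [hrec (n k) hpos.1 hpos.2 j, ← hj, h₀, h₁, Finset.sum_range_succ', Finset.mul_sum,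
      Finset.mul_sum, add_assoc, add_assoc, ← Finset.sum_add_distrib, add_comm (C _ * _)]
    congr 2
    refine Finset.sum_congr rfl fun l _ => ?_
    simp only [C_add, C_mul]
    ring
  · intro B hB hab l hl
    have hle := hpath.mono k.le_succ
    have hn := hab (n k) hle.1 hle.2 (by have := hpath.1 k; omega)
    have hb : ∀ m : ℕ × ℕ, m ≤ n k → k - d - 2 ≤ m.1 + m.2 → ∀ i : Fin 2, |b i m| ≤ B :=
      fun m hm hs i => (hab m (hm.trans hle).1 (hm.trans hle).2 hs i).2
    cases l with
    | zero =>
      have := one_le_pow₀ (n := d) (show 1 ≤ 2 * B by linarith)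
      calc |b j (n k)| ≤ B := (hn j).2
        _ ≤ 2 * B * (2 * B) ^ d := by nlinarith
    | succ l =>
      calc |a 0 (n k) * θ₀ l + a 1 (n k) * θ₁ l|
          ≤ |a 0 (n k)| * |θ₀ l| + |a 1 (n k)| * |θ₁ l| := by
            rw [← abs_mul, ← abs_mul]
            exact abs_add_le _ _
        _ ≤ B * (2 * B) ^ l + B * (2 * B) ^ l := by
            gcongr
            · exact (hn 0).1
            · exact hB₀ B hB hb l
            · exact (hn 1).1
            · exact hB₁ B hB hb l
        _ = 2 * B * (2 * B) ^ l := by ring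
        _ ≤ 2 * B * (2 * B) ^ d := by
            gcongr
            · linarith
            · omega
end

section
/- Let (n_k) be an up-right path with parameter d and let (Q_k)_{k∈ℕ²} be a family of real-valued functions on ℝ satisfying the type I nearest-neighbor recurrence relations with real coefficients a^{(1)}_k, a^{(2)}_k, b^{(1)}_k, b^{(2)}_k. Then for every sufficiently large k there exists ℓ_k ∈ {1, …, d−1} such that Q_{n_k + e_{⊥_k}}(x) = ∑_{i=0}^{ℓ_k} q^{(i)}_{n_k} Q_{n_{k+i+1}}(x) for all x ∈ ℝ, where the coefficients are defined recursively by q^{(0)}_{n_k} = 1 and q^{(j+1)}_{n_k} = q^{(j)}_{n_k}·(b^{(⊥_k)}_{n_{k+j}+e_{∥_k}} − b^{(∥_k)}_{n_{k+j}+e_{⊥_k}}) for j = 0, …, ℓ_k − 1. -/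
open Polynomial

/-- The index `∥_k ∈ {1,2}` (as an element of `Fin 2`) with `e_{∥_k} = n_{k+1} − n_k`. -/
def parIdx (n : ℕ → ℕ × ℕ) (k : ℕ) : Fin 2 :=
  if (n (k + 1)).1 = (n k).1 + 1 then 0 else 1

/-- The index `⊥_k ∈ {1,2}` (as an element of `Fin 2`), the one different from `∥_k`. -/
def perpIdx (n : ℕ → ℕ × ℕ) (k : ℕ) : Fin 2 :=
  if (n (k + 1)).1 = (n k).1 + 1 then 1 else 0

/-- Type I nearest-neighbor recurrence relations:
`x·Q_k(x) = Q_{k−e_j}(x) + b^{(j)}_{k−e_j} Q_k(x) + a^{(1)}_k Q_{k+e₁}(x) + a^{(2)}_k Q_{k+e₂}(x)`. -/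
def NNRecurrenceI (Q : ℕ × ℕ → ℝ → ℝ) (a b : Fin 2 → ℕ × ℕ → ℝ) : Prop :=
  ∀ k : ℕ × ℕ, 1 ≤ k.1 → 1 ≤ k.2 → ∀ j : Fin 2, ∀ x : ℝ,
    x * Q k x = Q (subIdx k (euv j)) x + b j (subIdx k (euv j)) * Q k x
      + a 0 k * Q (addIdx k (euv 0)) x + a 1 k * Q (addIdx k (euv 1)) x

/-- Subtracting the two recurrences at `m + e_p + e_s` relates the two neighbors of `m`. -/
theorem NNRecurrenceI.neighbor_eq {Q : ℕ × ℕ → ℝ → ℝ} {a b : Fin 2 → ℕ × ℕ → ℝ}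
    (hrec : NNRecurrenceI Q a b) {p s : Fin 2} (hps : p ≠ s) (m : ℕ × ℕ) (x : ℝ) :
    Q (addIdx m (euv s)) x = Q (addIdx m (euv p)) x
      + (b s (addIdx m (euv p)) - b p (addIdx m (euv s)))
        * Q (addIdx (addIdx m (euv p)) (euv s)) x := by
  obtain ⟨u, v⟩ := m
  have h0 := hrec (u + 1, v + 1) (by simp) (by simp) 0 x
  have h1 := hrec (u + 1, v + 1) (by simp) (by simp) 1 x
  simp only [subIdx, addIdx, euv, Fin.isValue, ↓reduceIte, one_ne_zero, add_tsub_cancel_right,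
    tsub_zero, add_zero] at h0 h1
  fin_cases p <;> fin_cases s <;>
    simp only [Fin.zero_eta, Fin.mk_one, Fin.isValue, ne_eq, not_true_eq_false] at hps <;>
    simp only [addIdx, euv, Fin.zero_eta, Fin.mk_one, Fin.isValue, ↓reduceIte, one_ne_zero,
      add_zero] <;>
    linarith

/-- Expansion of `Q_{n_k + e_s}` along a stretch of `L` consecutive steps `e_p` of the path. -/
theorem NNRecurrenceI.expand_along {Q : ℕ × ℕ → ℝ → ℝ} {a b : Fin 2 → ℕ × ℕ → ℝ}
    (hrec : NNRecurrenceI Q a b) {p s : Fin 2} (hps : p ≠ s) (n : ℕ → ℕ × ℕ) (k : ℕ)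
    {q : ℕ → ℝ} (hq0 : q 0 = 1)
    (hq : ∀ j, q (j + 1) = q j *
      (b s (addIdx (n (k + j)) (euv p)) - b p (addIdx (n (k + j)) (euv s))))
    (x : ℝ) (L : ℕ) (hstep : ∀ i < L, n (k + i + 1) = addIdx (n (k + i)) (euv p)) :
    Q (addIdx (n k) (euv s)) x = ∑ i ∈ Finset.range L, q i * Q (n (k + i + 1)) x
      + q L * Q (addIdx (n (k + L)) (euv s)) x := by
  induction L with
  | zero => simp [hq0]
  | succ L ih =>
    rw [ih fun i hi => hstep i (by omega), Finset.sum_range_succ,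
      hrec.neighbor_eq hps (n (k + L)) x, hq L, ← hstep L (by omega), ← add_assoc k L 1]
    ring

/-- Among `d` consecutive steps of an up-right path, every direction is avoided at least once. -/
theorem IsUpRightPath.exists_step_ne {d : ℕ} {n : ℕ → ℕ × ℕ} (hpath : IsUpRightPath d n)
    (p : Fin 2) (k : ℕ) : ∃ l < d, n (k + l + 1) ≠ addIdx (n (k + l)) (euv p) := by
  by_contra! h
  have hconst : ∀ L ≤ d, if p = 0 then (n (k + L)).2 = (n k).2 else (n (k + L)).1 = (n k).1 := by
    intro L
    induction L with
    | zero => simp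
    | succ L ih =>
      intro hL
      rw [← add_assoc, h L (by omega)]
      have := ih (by omega)
      split_ifs at this ⊢ with hp <;> simp [addIdx, euv, hp, this]
  have hd := hconst d le_rfl
  have := hpath.2.2 k
  split_ifs at hd <;> omega

theorem IsUpRightPath.step_eq_or {d : ℕ} {n : ℕ → ℕ × ℕ} (hpath : IsUpRightPath d n)
    {p s : Fin 2} (hps : p ≠ s) (k : ℕ) :
    n (k + 1) = addIdx (n k) (euv p) ∨ n (k + 1) = addIdx (n k) (euv s) := by
  have := hpath.2.1 k
  fin_cases p <;> fin_cases s <;> simp_all [or_comm]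

theorem IsUpRightPath.step_parIdx {d : ℕ} {n : ℕ → ℕ × ℕ} (hpath : IsUpRightPath d n) (k : ℕ) :
    n (k + 1) = addIdx (n k) (euv (parIdx n k)) := by
  rcases hpath.2.1 k with h | h <;> simp [parIdx, h, addIdx, euv]

theorem parIdx_ne_perpIdx (n : ℕ → ℕ × ℕ) (k : ℕ) : parIdx n k ≠ perpIdx n k := by
  unfold parIdx perpIdx
  split_ifs <;> simp

/-- **Off-path expansion of type I functions:**
`Q_{n_k + e_{⊥_k}} = ∑_{i=0}^{ℓ_k} q^{(i)}_{n_k} Q_{n_{k+i+1}}` with `ℓ_k ∈ {1,…,d−1}` and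
recursively defined coefficients. -/
theorem stmt7 (d : ℕ) (hd : 2 ≤ d) (n : ℕ → ℕ × ℕ) (hpath : IsUpRightPath d n)
    (Q : ℕ × ℕ → ℝ → ℝ) (a b : Fin 2 → ℕ × ℕ → ℝ) (hrec : NNRecurrenceI Q a b) :
    ∃ K : ℕ, ∀ k, K ≤ k → ∃ lk : ℕ, 1 ≤ lk ∧ lk ≤ d - 1 ∧ ∃ q : ℕ → ℝ,
      q 0 = 1 ∧
      (∀ j < lk, q (j + 1) = q j *
        (b (perpIdx n k) (addIdx (n (k + j)) (euv (parIdx n k)))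
          - b (parIdx n k) (addIdx (n (k + j)) (euv (perpIdx n k))))) ∧
      ∀ x : ℝ, Q (addIdx (n k) (euv (perpIdx n k))) x
        = ∑ i ∈ Finset.range (lk + 1), q i * Q (n (k + i + 1)) x := by
  refine ⟨0, fun k _ => ?_⟩
  have hps := parIdx_ne_perpIdx n k
  have hpar := hpath.step_parIdx k
  set p := parIdx n k
  set s := perpIdx n k
  have hex := hpath.exists_step_ne p k
  obtain ⟨hld, hlne⟩ := Nat.find_spec hex
  have hmin : ∀ i < Nat.find hex, n (k + i + 1) = addIdx (n (k + i)) (euv p) := by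
    intro i hi
    by_contra hne
    exact Nat.find_min hex hi ⟨by omega, hne⟩
  set l := Nat.find hex
  have hl : l ≠ 0 := fun h0 => hlne (by simpa [h0] using hpar)
  have hlast := (hpath.step_eq_or hps (k + l)).resolve_left hlne
  let q : ℕ → ℝ := fun j => ∏ i ∈ Finset.range j,
    (b s (addIdx (n (k + i)) (euv p)) - b p (addIdx (n (k + i)) (euv s)))
  have hq0 : q 0 = 1 := Finset.prod_range_zero _
  have hq : ∀ j, q (j + 1) = q j *
      (b s (addIdx (n (k + j)) (euv p)) - b p (addIdx (n (k + j)) (euv s))) :=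
    fun j => Finset.prod_range_succ _ j
  refine ⟨l, by omega, by omega, q, hq0, fun j _ => hq j, fun x => ?_⟩
  rw [hrec.expand_along hps n k hq0 hq x l hmin, Finset.sum_range_succ, hlast]
end

section
/- Let (n_k) be an up-right path with parameter d and let (P_k)_{k∈ℕ²} be a family of real polynomials satisfying the type II nearest-neighbor recurrence relations with real coefficients a^{(1)}_k, a^{(2)}_k, b^{(1)}_k, b^{(2)}_k. Then for every sufficiently large k there exists ν_k ∈ {1, …, d−1} such that P_{n_k − e_{⊥_{k−1}}}(x) = ∑_{i=0}^{ν_k} p^{(i)}_{n_k} P_{n_{k−i−1}}(x) identically in x, where the coefficients are defined recursively by p^{(0)}_{n_k} = 1 and p^{(j+1)}_{n_k} = p^{(j)}_{n_k}·(b^{(⊥_{k−1})}_{n_{k−j−1} − e_{⊥_{k−1}}} − b^{(∥_{k−1})}_{n_{k−j−1} − e_{⊥_{k−1}}}) for j = 0, …, ν_k − 1. -/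
open Polynomial

lemma NNRecurrenceII.add_euv_eq {P : ℕ × ℕ → Polynomial ℝ} {a b : Fin 2 → ℕ × ℕ → ℝ}
    (hrec : NNRecurrenceII P a b) {m : ℕ × ℕ} (h₁ : 1 ≤ m.1) (h₂ : 1 ≤ m.2) (q r : Fin 2) :
    P (addIdx m (euv r)) = P (addIdx m (euv q)) + C (b q m - b r m) * P m := by
  rw [C_sub]
  linear_combination hrec m h₁ h₂ q - hrec m h₁ h₂ r

lemma subIdx_addIdx_euv_comm {x : ℕ × ℕ} (h₁ : 1 ≤ x.1) (h₂ : 1 ≤ x.2) (q r : Fin 2) :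
    subIdx (addIdx x (euv r)) (euv q) = addIdx (subIdx x (euv q)) (euv r) := by
  fin_cases q <;> fin_cases r <;> simp [subIdx, addIdx, euv, Prod.ext_iff] <;> omega

lemma addIdx_subIdx_euv {x : ℕ × ℕ} (h₁ : 1 ≤ x.1) (h₂ : 1 ≤ x.2) (q : Fin 2) :
    addIdx (subIdx x (euv q)) (euv q) = x := by
  fin_cases q <;> simp [subIdx, addIdx, euv, Prod.ext_iff] <;> omega

lemma subIdx_addIdx_euv (x : ℕ × ℕ) (q : Fin 2) :
    subIdx (addIdx x (euv q)) (euv q) = x := by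
  fin_cases q <;> simp [subIdx, addIdx, euv]

lemma one_le_subIdx_euv {x : ℕ × ℕ} (h₁ : 2 ≤ x.1) (h₂ : 2 ≤ x.2) (q : Fin 2) :
    1 ≤ (subIdx x (euv q)).1 ∧ 1 ≤ (subIdx x (euv q)).2 := by
  fin_cases q <;> simp [subIdx, euv] <;> omega

namespace IsUpRightPath

variable {d : ℕ} {n : ℕ → ℕ × ℕ}

lemma succ_eq_of_ne (hpath : IsUpRightPath d n) {q r : Fin 2} (hqr : q ≠ r) {t : ℕ}
    (h : n (t + 1) ≠ addIdx (n t) (euv q)) : n (t + 1) = addIdx (n t) (euv r) := by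
  have := hpath.2.1 t
  fin_cases q <;> fin_cases r <;> simp_all

lemma perpIdx_ne_parIdx (k : ℕ) : perpIdx n k ≠ parIdx n k := by
  unfold perpIdx parIdx
  split_ifs <;> decide

lemma succ_ne_add_perpIdx (hpath : IsUpRightPath d n) (k : ℕ) :
    n (k + 1) ≠ addIdx (n k) (euv (perpIdx n k)) := by
  intro h
  have h₁ := hpath.1 k
  have h₂ := hpath.1 (k + 1)
  unfold perpIdx at h
  split_ifs at h with h₃ <;> rw [h] at h₂ h₃ <;> simp [addIdx, euv] at h₂ h₃

/-- Every direction is taken within any `d` consecutive steps. -/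
lemma exists_step (hpath : IsUpRightPath d n) (q : Fin 2) (t : ℕ) :
    ∃ i < d, n (t + i + 1) = addIdx (n (t + i)) (euv q) := by
  by_contra! hne
  obtain ⟨h₁, h₂⟩ := hpath.2.2 t
  fin_cases q
  · have key : ∀ i ≤ d, (n (t + i)).1 = (n t).1 := by
      intro i
      induction i with
      | zero => simp
      | succ i ih =>
        intro hi
        rw [← add_assoc, hpath.succ_eq_of_ne (r := 1) (by decide) (hne i hi), ← ih (by omega)]
        simp [addIdx, euv]
    have := key d le_rfl
    omega
  · have key : ∀ i ≤ d, (n (t + i)).2 = (n t).2 := by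
      intro i
      induction i with
      | zero => simp
      | succ i ih =>
        intro hi
        rw [← add_assoc, hpath.succ_eq_of_ne (r := 0) (by decide) (hne i hi), ← ih (by omega)]
        simp [addIdx, euv]
    have := key d le_rfl
    omega

lemma two_le (hpath : IsUpRightPath d n) {t : ℕ} (ht : 2 * d ≤ t) :
    2 ≤ (n t).1 ∧ 2 ≤ (n t).2 := by
  obtain ⟨s, rfl⟩ := Nat.exists_eq_add_of_le ht
  have h₁ := hpath.2.2 s
  have h₂ := hpath.2.2 (s + d)
  rw [show s + d + d = 2 * d + s by ring] at h₂
  omega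

/-- Unrolling the recurrence along a run of `m` steps in direction `r`. -/
lemma expansion_of_run (hpath : IsUpRightPath d n) {P : ℕ × ℕ → Polynomial ℝ}
    {a b : Fin 2 → ℕ × ℕ → ℝ} (hrec : NNRecurrenceII P a b) {p : ℕ → ℝ} {q r : Fin 2} {k m : ℕ}
    (hp : p 0 = 1)
    (hp_succ : ∀ j, p (j + 1) = p j *
      (b q (subIdx (n (k - j - 1)) (euv q)) - b r (subIdx (n (k - j - 1)) (euv q))))
    (hk : 2 * d + m ≤ k)
    (hrun : ∀ i < m, n (k - i) = addIdx (n (k - i - 1)) (euv r)) :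
    P (subIdx (n k) (euv q)) = ∑ i ∈ Finset.range m, C (p i) * P (n (k - i - 1))
      + C (p m) * P (subIdx (n (k - m)) (euv q)) := by
  induction m with
  | zero => simp [hp]
  | succ m ih =>
    rw [ih (by omega) fun i hi => hrun i (by omega), Finset.sum_range_succ, hrun m (by omega),
      hp_succ, ← Nat.sub_sub k m 1]
    obtain ⟨h₁, h₂⟩ := hpath.two_le (t := k - m - 1) (by omega)
    obtain ⟨h₃, h₄⟩ := one_le_subIdx_euv h₁ h₂ q
    rw [subIdx_addIdx_euv_comm (by omega) (by omega), hrec.add_euv_eq h₃ h₄ q r,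
      addIdx_subIdx_euv (by omega) (by omega), C_mul]
    ring

end IsUpRightPath

/-- **Off-path expansion of type II polynomials:**
`P_{n_k − e_{⊥_{k−1}}} = ∑_{i=0}^{ν_k} p^{(i)}_{n_k} P_{n_{k−i−1}}` with `ν_k ∈ {1,…,d−1}` and
recursively defined coefficients. -/
theorem stmt8 (d : ℕ) (hd : 2 ≤ d) (n : ℕ → ℕ × ℕ) (hpath : IsUpRightPath d n)
    (P : ℕ × ℕ → Polynomial ℝ) (a b : Fin 2 → ℕ × ℕ → ℝ) (hrec : NNRecurrenceII P a b) :
    ∃ K : ℕ, ∀ k, K ≤ k → ∃ nk : ℕ, 1 ≤ nk ∧ nk ≤ d - 1 ∧ ∃ p : ℕ → ℝ,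
      p 0 = 1 ∧
      (∀ j < nk, p (j + 1) = p j *
        (b (perpIdx n (k - 1)) (subIdx (n (k - j - 1)) (euv (perpIdx n (k - 1))))
          - b (parIdx n (k - 1)) (subIdx (n (k - j - 1)) (euv (perpIdx n (k - 1)))))) ∧
      P (subIdx (n k) (euv (perpIdx n (k - 1))))
        = ∑ i ∈ Finset.range (nk + 1), Polynomial.C (p i) * P (n (k - i - 1)) := by
  classical
  refine ⟨4 * d, fun k hk => ?_⟩
  have hstep := hpath.succ_ne_add_perpIdx (k - 1)
  have hqr : perpIdx n (k - 1) ≠ parIdx n (k - 1) := IsUpRightPath.perpIdx_ne_parIdx (k - 1)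
  generalize perpIdx n (k - 1) = q at *
  generalize parIdx n (k - 1) = r at *
  rw [show k - 1 + 1 = k by omega] at hstep
  have hex : ∃ i, i < d ∧ n (k - i) = addIdx (n (k - i - 1)) (euv q) := by
    obtain ⟨i, hi, h⟩ := hpath.exists_step q (k - d)
    refine ⟨d - 1 - i, by omega, ?_⟩
    rwa [show k - (d - 1 - i) = k - d + i + 1 by omega, Nat.add_sub_cancel]
  obtain ⟨hlt, hlast⟩ := Nat.find_spec hex
  have hmin : ∀ i < Nat.find hex, _ := fun i hi => Nat.find_min hex hi
  generalize Nat.find hex = m at *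
  have hm : m ≠ 0 := by
    rintro rfl
    exact hstep hlast
  let p : ℕ → ℝ := fun j => ∏ i ∈ Finset.range j,
    (b q (subIdx (n (k - i - 1)) (euv q)) - b r (subIdx (n (k - i - 1)) (euv q)))
  have hp_succ : ∀ j, p (j + 1) = p j *
      (b q (subIdx (n (k - j - 1)) (euv q)) - b r (subIdx (n (k - j - 1)) (euv q))) :=
    fun j => Finset.prod_range_succ _ j
  refine ⟨m, by omega, by omega, p, Finset.prod_range_zero _, fun j _ => hp_succ j, ?_⟩
  rw [hpath.expansion_of_run hrec (Finset.prod_range_zero _) hp_succ (m := m) (by omega),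
    Finset.sum_range_succ, hlast, subIdx_addIdx_euv]
  intro i hi
  have hne : n (k - i) ≠ addIdx (n (k - i - 1)) (euv q) := fun h => hmin i hi ⟨by omega, h⟩
  rw [show k - i = k - i - 1 + 1 by omega, Nat.add_sub_cancel] at hne ⊢
  exact hpath.succ_eq_of_ne hqr hne
end

section
/- Let n ≥ 1 be an integer and h : ℝ → ℝ a measurable function with ∫_ℝ (1+|x|)^n |h(x)| dx < ∞, satisfying ∫_ℝ x^s h(x) dx = 0 for 0 ≤ s ≤ n−2 and ∫_ℝ x^{n−1} h(x) dx = 1. Then for every z ∈ ℂ∖ℝ: (a) for every real polynomial P with deg P ≤ n−1, P(z)·C[h](z) = C[P·h](z); and (b) for every monic real polynomial P of degree n, P(z)·C[h](z) = −1 + C[P·h](z). -/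
open MeasureTheory Polynomial

theorem integrable_pow_mul_of_weighted {n : ℕ} {h : ℝ → ℝ} (hmeas : Measurable h)
    (hint : Integrable (fun x : ℝ => (1 + |x|) ^ n * |h x|)) {i : ℕ} (hi : i ≤ n) :
    Integrable (fun x : ℝ => x ^ i * h x) := by
  refine hint.mono' (by fun_prop) (.of_forall fun x => ?_)
  rw [Real.norm_eq_abs, abs_mul, abs_pow]
  gcongr
  calc |x| ^ i ≤ (1 + |x|) ^ i := by gcongr; linarith
    _ ≤ (1 + |x|) ^ n := pow_le_pow_right₀ (by linarith [abs_nonneg x]) hi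

theorem ofReal_sub_ne_zero_of_im_ne_zero {z : ℂ} (hz : z.im ≠ 0) (x : ℝ) : (x : ℂ) - z ≠ 0 := by
  intro hx
  apply hz
  simpa using congrArg Complex.im hx

theorem integrable_div_ofReal_sub {h : ℝ → ℝ} (hh : Integrable h) {z : ℂ} (hz : z.im ≠ 0) :
    Integrable (fun x : ℝ => (h x : ℂ) / ((x : ℂ) - z)) := by
  have hbound : ∀ x : ℝ, ‖((x : ℂ) - z)⁻¹‖ ≤ |z.im|⁻¹ := fun x => by
    rw [norm_inv]
    exact inv_anti₀ (abs_pos.2 hz) (by simpa using Complex.abs_im_le_norm ((x : ℂ) - z))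
  have hh' : Integrable (fun x : ℝ => (h x : ℂ)) := hh.ofReal
  simpa only [div_eq_mul_inv] using
    hh'.mul_bdd (c := |z.im|⁻¹) (by fun_prop) (.of_forall hbound)

theorem integral_eval_mul_eq_sum_moments {n : ℕ} {h : ℝ → ℝ} (R : ℂ[X]) (hR : R.natDegree < n)
    (hint : ∀ i < n, Integrable (fun x : ℝ => x ^ i * h x)) :
    Integrable (fun x : ℝ => R.eval (x : ℂ) * (h x : ℂ)) ∧
      ∫ x : ℝ, R.eval (x : ℂ) * (h x : ℂ) =
        ∑ i ∈ Finset.range n, R.coeff i * ((∫ x : ℝ, x ^ i * h x : ℝ) : ℂ) := by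
  have hexp : (fun x : ℝ => R.eval (x : ℂ) * (h x : ℂ)) =
      fun x : ℝ => ∑ i ∈ Finset.range n, R.coeff i * ((x ^ i * h x : ℝ) : ℂ) := by
    funext x
    rw [eval_eq_sum_range' hR, Finset.sum_mul]
    exact Finset.sum_congr rfl fun i _ => by push_cast; ring
  have hterm : ∀ i ∈ Finset.range n,
      Integrable (fun x : ℝ => R.coeff i * ((x ^ i * h x : ℝ) : ℂ)) := fun i hi =>
    (hint i (Finset.mem_range.1 hi)).ofReal.const_mul _
  rw [hexp]
  refine ⟨integrable_finsetSum _ hterm, ?_⟩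
  rw [integral_finsetSum _ hterm]
  refine Finset.sum_congr rfl fun i _ => ?_
  rw [integral_const_mul, integral_complex_ofReal]

/-- Multiplying the Cauchy transform by a polynomial of degree at most `n` costs only the
coefficient of degree `n`. -/
theorem aeval_mul_cauchyTransform {n : ℕ} (hn : 1 ≤ n) {h : ℝ → ℝ} (hmeas : Measurable h)
    (hint : Integrable (fun x : ℝ => (1 + |x|) ^ n * |h x|))
    (hmom0 : ∀ s : ℕ, s + 2 ≤ n → ∫ x : ℝ, x ^ s * h x = 0)
    (hmom1 : ∫ x : ℝ, x ^ (n - 1) * h x = 1)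
    {z : ℂ} (hz : z.im ≠ 0) (P : ℝ[X]) (hP : P.natDegree ≤ n) :
    aeval z P * ∫ x : ℝ, (h x : ℂ) / ((x : ℂ) - z)
      = -(P.coeff n : ℂ) + ∫ x : ℝ, ((P.eval x * h x : ℝ) : ℂ) / ((x : ℂ) - z) := by
  obtain ⟨m, rfl⟩ : ∃ m, n = m + 1 := ⟨n - 1, by omega⟩
  set Q : ℂ[X] := P.map (algebraMap ℝ ℂ) with hQ
  set R : ℂ[X] := Q /ₘ (X - C z) with hRdef
  have hQR : C (Q.eval z) + (X - C z) * R = Q := by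
    rw [← modByMonic_X_sub_C_eq_C_eval]
    exact modByMonic_add_div Q _
  have hQz : aeval z P = Q.eval z := by rw [hQ, eval_map_algebraMap]
  have hRdeg : R.natDegree < m + 1 := by
    rw [hRdef, natDegree_divByMonic _ (monic_X_sub_C z), natDegree_X_sub_C]
    have : Q.natDegree ≤ P.natDegree := natDegree_map_le
    omega
  have hRcoeff : R.coeff m = (P.coeff (m + 1) : ℂ) := by
    have hc := congrArg (fun p => coeff p (m + 1)) hQR
    simpa [sub_mul, coeff_X_mul, coeff_C_mul, coeff_C_succ,
      coeff_eq_zero_of_natDegree_lt hRdeg, hQ] using hc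
  have hpow : ∀ i < m + 1, Integrable (fun x : ℝ => x ^ i * h x) := fun i hi =>
    integrable_pow_mul_of_weighted hmeas hint hi.le
  have hh : Integrable h := by simpa using hpow 0 (by omega)
  obtain ⟨hRint, hRval⟩ := integral_eval_mul_eq_sum_moments R hRdeg hpow
  have hRone : ∫ x : ℝ, R.eval (x : ℂ) * (h x : ℂ) = (P.coeff (m + 1) : ℂ) := by
    rw [hRval, Finset.sum_range_succ, Finset.sum_eq_zero fun i hi => ?_]
    · simp only [Nat.add_sub_cancel] at hmom1
      simp [hmom1, hRcoeff]
    · rw [hmom0 i (by have := Finset.mem_range.1 hi; omega)]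
      simp
  have hsplit : ∀ x : ℝ, ((P.eval x * h x : ℝ) : ℂ) / ((x : ℂ) - z) =
      aeval z P * ((h x : ℂ) / ((x : ℂ) - z)) + R.eval (x : ℂ) * (h x : ℂ) := fun x => by
    have hx := ofReal_sub_ne_zero_of_im_ne_zero hz x
    have hev : ((P.eval x : ℝ) : ℂ) = aeval z P + ((x : ℂ) - z) * R.eval (x : ℂ) := by
      have he := congrArg (eval (x : ℂ)) hQR
      simp only [eval_add, eval_mul, eval_sub, eval_X, eval_C] at he
      rw [hQz, he, hQ, eval_map_algebraMap]
      exact (aeval_algebraMap_apply_eq_algebraMap_eval x P).symm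
    rw [Complex.ofReal_mul, hev]
    field_simp
  simp_rw [hsplit]
  rw [integral_add ((integrable_div_ofReal_sub hh hz).const_mul _) hRint, integral_const_mul,
    hRone]
  ring

/-- **Cauchy transform identities for a function with prescribed moments.** -/
theorem stmt11 (n : ℕ) (hn : 1 ≤ n) (h : ℝ → ℝ) (hmeas : Measurable h)
    (hint : Integrable (fun x : ℝ => (1 + |x|) ^ n * |h x|))
    (hmom0 : ∀ s : ℕ, s + 2 ≤ n → ∫ x : ℝ, x ^ s * h x = 0)
    (hmom1 : ∫ x : ℝ, x ^ (n - 1) * h x = 1)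
    (z : ℂ) (hz : z.im ≠ 0) :
    (∀ P : Polynomial ℝ, P.degree < (n : WithBot ℕ) →
      Polynomial.aeval z P * ∫ x : ℝ, (h x : ℂ) / ((x : ℂ) - z)
        = ∫ x : ℝ, ((P.eval x * h x : ℝ) : ℂ) / ((x : ℂ) - z)) ∧
    (∀ P : Polynomial ℝ, P.Monic → P.natDegree = n →
      Polynomial.aeval z P * ∫ x : ℝ, (h x : ℂ) / ((x : ℂ) - z)
        = -1 + ∫ x : ℝ, ((P.eval x * h x : ℝ) : ℂ) / ((x : ℂ) - z)) := by
  have key := aeval_mul_cauchyTransform hn hmeas hint hmom0 hmom1 hz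
  refine ⟨fun P hP => ?_, fun P hmonic hdeg => ?_⟩
  · rw [key P (natDegree_le_of_degree_le hP.le), coeff_eq_zero_of_degree_lt hP]
    simp
  · rw [key P hdeg.le, ← hdeg, hmonic.coeff_natDegree]
    simp
end

section
/- Assume the data (V, a, α, p₀, p₁, λ) forms an admissible spectral curve. Then λ has compact support. -/
open MeasureTheory Polynomial

noncomputable section

/-- The Cauchy transform `C^λ(z) = ∫ dλ(s)/(s − z)` of a measure on `ℝ`. -/
def cauchyT (lam : Measure ℝ) (z : ℂ) : ℂ := ∫ s : ℝ, ((s : ℂ) - z)⁻¹ ∂lam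

/-- The solution `ξ₁(z) = C^λ(z) + V′(z)`. -/
def xi1 (V : Polynomial ℝ) (lam : Measure ℝ) (z : ℂ) : ℂ :=
  cauchyT lam z + Polynomial.aeval z V.derivative

/-- The coefficient `v_k` in `V(z) = ∑_{k=1}^m (v_k/k) z^k`, i.e. `v_k = k·(coeff of z^k)`. -/
def vcoef (V : Polynomial ℝ) (k : ℕ) : ℝ := (k : ℝ) * V.coeff k

/-- An **admissible spectral curve**: an irreducible real cubic
`ξ³ − V′(z)ξ² + p₁(z)ξ + p₀(z) = 0` with `deg p₁ ≤ m−2`,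
`p₀(z) = v_m a² z^{m−1} + (v_{m−1}a² + v_m a(2α−1)) z^{m−2} + …`, one of whose
solutions is `ξ₁(z) = C^λ(z) + V′(z)` for a probability measure `λ` on `ℝ`. -/
structure AdmissibleSpectralCurve (V : Polynomial ℝ) (a α : ℝ) (p₀ p₁ : Polynomial ℝ)
    (lam : Measure ℝ) : Prop where
  hdeg : 2 ≤ V.natDegree
  hconst : V.coeff 0 = 0
  ha : 0 < a
  halpha0 : 0 < α
  halpha1 : α < 1
  hirr : Irreducible (Polynomial.X ^ 3 + Polynomial.C (-V.derivative) * Polynomial.X ^ 2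
    + Polynomial.C p₁ * Polynomial.X + Polynomial.C p₀ : Polynomial (Polynomial ℝ))
  hp₁ : p₁.degree ≤ ((V.natDegree - 2 : ℕ) : WithBot ℕ)
  hp₀deg : p₀.natDegree ≤ V.natDegree - 1
  hp₀top : p₀.coeff (V.natDegree - 1) = vcoef V V.natDegree * a ^ 2
  hp₀next : p₀.coeff (V.natDegree - 2)
    = vcoef V (V.natDegree - 1) * a ^ 2 + vcoef V V.natDegree * a * (2 * α - 1)
  hprob : IsProbabilityMeasure lam
  hsol : ∀ z : ℂ, z.im ≠ 0 →
    xi1 V lam z ^ 3 - Polynomial.aeval z V.derivative * xi1 V lam z ^ 2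
      + Polynomial.aeval z p₁ * xi1 V lam z + Polynomial.aeval z p₀ = 0

open Set Filter Topology Bornology ComplexConjugate

/-! ### Bounds for the Cauchy transform -/

lemma ofReal_sub_ne_zero {z : ℂ} (hz : z.im ≠ 0) (s : ℝ) : (s : ℂ) - z ≠ 0 := by
  intro h
  apply hz
  simpa using congrArg Complex.im h

lemma norm_inv_ofReal_sub_le {z : ℂ} (hz : z.im ≠ 0) (s : ℝ) :
    ‖((s : ℂ) - z)⁻¹‖ ≤ |z.im|⁻¹ := by
  rw [norm_inv]
  refine inv_anti₀ (abs_pos.mpr hz) ?_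
  simpa using Complex.abs_im_le_norm ((s : ℂ) - z)

lemma aestronglyMeasurable_inv_ofReal_sub (lam : Measure ℝ) (z : ℂ) :
    AEStronglyMeasurable (fun s : ℝ => ((s : ℂ) - z)⁻¹) lam :=
  ((Complex.measurable_ofReal.sub_const z).inv).aestronglyMeasurable

lemma integrable_inv_ofReal_sub (lam : Measure ℝ) [IsProbabilityMeasure lam] {z : ℂ}
    (hz : z.im ≠ 0) : Integrable (fun s : ℝ => ((s : ℂ) - z)⁻¹) lam :=
  Integrable.of_bound (aestronglyMeasurable_inv_ofReal_sub lam z) |z.im|⁻¹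
    (ae_of_all _ (norm_inv_ofReal_sub_le hz))

lemma norm_cauchyT_le (lam : Measure ℝ) [IsProbabilityMeasure lam] {z : ℂ} (hz : z.im ≠ 0) :
    ‖cauchyT lam z‖ ≤ |z.im|⁻¹ := by
  simpa [cauchyT] using
    norm_integral_le_of_norm_le_const (μ := lam) (ae_of_all _ (norm_inv_ofReal_sub_le hz))

lemma continuousOn_cauchyT_vertical (lam : Measure ℝ) [IsProbabilityMeasure lam] (x : ℝ) {y : ℝ}
    (hy : 0 < y) : ContinuousOn (fun t : ℝ => cauchyT lam ⟨x, t⟩) (Ici y) := by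
  unfold cauchyT
  refine continuousOn_of_dominated (bound := fun _ => y⁻¹)
    (fun t _ => aestronglyMeasurable_inv_ofReal_sub lam _) (fun t ht => ae_of_all _ fun s => ?_)
    (integrable_const _) (ae_of_all _ fun s => ?_)
  · have ht0 : 0 < t := hy.trans_le ht
    refine (norm_inv_ofReal_sub_le (z := ⟨x, t⟩) ht0.ne' s).trans ?_
    exact inv_anti₀ hy (ht.trans (le_abs_self t))
  · refine ContinuousOn.inv₀ ?_ fun t ht => ofReal_sub_ne_zero (z := ⟨x, t⟩) (hy.trans_le ht).ne' s
    have : (fun t : ℝ => (s : ℂ) - (⟨x, t⟩ : ℂ)) = fun t : ℝ => (s : ℂ) - (x + t * Complex.I) := by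
      funext t
      rw [Complex.mk_eq_add_mul_I]
    rw [this]
    fun_prop

lemma measureReal_Icc_le_im_cauchyT (lam : Measure ℝ) [IsProbabilityMeasure lam] (x : ℝ) {y : ℝ}
    (hy : 0 < y) : lam.real (Icc (x - y) (x + y)) ≤ 2 * y * (cauchyT lam ⟨x, y⟩).im := by
  have hint := integrable_inv_ofReal_sub lam (z := ⟨x, y⟩) hy.ne'
  have him : (cauchyT lam ⟨x, y⟩).im = ∫ s : ℝ, (((s : ℂ) - ⟨x, y⟩)⁻¹).im ∂lam :=
    (integral_im hint).symm
  have hle : ∫ s : ℝ, (Icc (x - y) (x + y)).indicator (fun _ => 1 / (2 * y)) s ∂lam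
      ≤ ∫ s : ℝ, (((s : ℂ) - ⟨x, y⟩)⁻¹).im ∂lam := by
    refine integral_mono ((integrable_const _).indicator measurableSet_Icc) hint.im fun s => ?_
    have hval : (((s : ℂ) - ⟨x, y⟩)⁻¹).im = y / ((s - x) ^ 2 + y ^ 2) := by
      rw [Complex.inv_im, Complex.normSq_apply]
      simp only [Complex.sub_im, Complex.sub_re, Complex.ofReal_im, Complex.ofReal_re]
      ring
    change _ ≤ (((s : ℂ) - ⟨x, y⟩)⁻¹).im
    rw [hval]
    by_cases hs : s ∈ Icc (x - y) (x + y)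
    · rw [indicator_of_mem hs, div_le_div_iff₀ (by positivity) (by positivity)]
      have := hs.1
      have := hs.2
      nlinarith
    · rw [indicator_of_notMem hs]
      positivity
  rw [integral_indicator_const _ measurableSet_Icc, ← him, smul_eq_mul, mul_one_div,
    div_le_iff₀ (by positivity)] at hle
  linarith

lemma norm_cauchyT_le_one (lam : Measure ℝ) [IsProbabilityMeasure lam] {R : ℝ}
    (hR : ∀ z : ℂ, R ≤ ‖z‖ → z.im ≠ 0 → ‖cauchyT lam z‖ ≠ 1) {x y : ℝ} (hx : R ≤ |x|)
    (hy : 0 < y) : ‖cauchyT lam ⟨x, y⟩‖ ≤ 1 := by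
  by_contra! hgt
  have hT : ‖cauchyT lam ⟨x, y + 1⟩‖ ≤ 1 := by
    refine (norm_cauchyT_le lam (z := ⟨x, y + 1⟩) (by positivity)).trans (inv_le_one_of_one_le₀ ?_)
    rw [abs_of_pos (by positivity)]
    linarith
  obtain ⟨t, ht, ht1⟩ := intermediate_value_Icc' (by linarith : y ≤ y + 1)
    (((continuousOn_cauchyT_vertical lam x hy).mono Icc_subset_Ici_self).norm) ⟨hT, hgt.le⟩
  exact hR ⟨x, t⟩ (hx.trans (Complex.abs_re_le_norm ⟨x, t⟩)) (hy.trans_le ht.1).ne' ht1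

/-! ### Null intervals from a quadratic bound -/

lemma measure_Icc_eq_zero_of_quadratic_bound (lam : Measure ℝ) [IsFiniteMeasure lam] (b K : ℝ)
    (hK : ∀ x ∈ Icc b (b + 1), ∀ y : ℝ, 0 < y → y ≤ 1 →
      lam.real (Icc (x - y) (x + y)) ≤ K * y ^ 2) :
    lam (Icc b (b + 1)) = 0 := by
  have hbound : ∀ n : ℕ, lam.real (Icc b (b + 1)) ≤ 2 * K * (1 / ((n : ℝ) + 1)) := by
    intro n
    set y : ℝ := 1 / ((n : ℝ) + 1) with hy
    have hn : (0 : ℝ) < (n : ℝ) + 1 := by positivity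
    have hy0 : 0 < y := by positivity
    have hy1 : y ≤ 1 := by
      rw [hy, div_le_one hn]
      linarith [(Nat.cast_nonneg n : (0 : ℝ) ≤ n)]
    have hny : ((n : ℝ) + 1) * y = 1 := by
      rw [hy]
      field_simp
    have hcover : Icc b (b + 1) ⊆
        ⋃ i ∈ Finset.range (n + 2), Icc (b + i * y - y) (b + i * y + y) := by
      intro s hs
      have hnonneg : 0 ≤ (s - b) / y := div_nonneg (by linarith [hs.1]) hy0.le
      have h1 := Nat.floor_le hnonneg
      have h2 := Nat.lt_floor_add_one ((s - b) / y)
      rw [le_div_iff₀ hy0] at h1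
      rw [div_lt_iff₀ hy0] at h2
      refine mem_iUnion₂.mpr ⟨⌊(s - b) / y⌋₊, ?_, by constructor <;> linarith⟩
      rw [Finset.mem_range]
      have h3 : (⌊(s - b) / y⌋₊ : ℝ) ≤ n + 1 := by
        refine le_of_mul_le_mul_right ?_ hy0
        linarith [hs.2]
      have : ⌊(s - b) / y⌋₊ ≤ n + 1 := by exact_mod_cast h3
      omega
    calc lam.real (Icc b (b + 1))
        ≤ lam.real (⋃ i ∈ Finset.range (n + 2), Icc (b + i * y - y) (b + i * y + y)) :=
          measureReal_mono hcover
            ((measure_biUnion_lt_top (Finset.finite_toSet _) fun _ _ => measure_lt_top _ _).ne)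
      _ ≤ ∑ i ∈ Finset.range (n + 2), lam.real (Icc (b + i * y - y) (b + i * y + y)) :=
          measureReal_biUnion_finset_le _ _
      _ ≤ ∑ i ∈ Finset.range (n + 2), K * y ^ 2 := by
          refine Finset.sum_le_sum fun i hi => hK _ ⟨?_, ?_⟩ y hy0 hy1
          · have : 0 ≤ (i : ℝ) * y := by positivity
            linarith
          · have hi' : (i : ℝ) ≤ n + 1 := by
              have := Finset.mem_range.mp hi
              exact_mod_cast (by omega : i ≤ n + 1)
            have := mul_le_mul_of_nonneg_right hi' hy0.le
            linarith
      _ = K * y * (((n : ℝ) + 1) * y + y) := by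
          simp only [Finset.sum_const, Finset.card_range, nsmul_eq_mul]
          push_cast
          ring
      _ ≤ 2 * K * y := by
          have hK0 : 0 ≤ K := by
            have := hK b ⟨le_rfl, by linarith⟩ 1 one_pos le_rfl
            have := measureReal_nonneg (μ := lam) (s := Icc (b - 1) (b + 1))
            linarith
          rw [hny]
          nlinarith [mul_nonneg hK0 hy0.le]
  have hlim : Tendsto (fun n : ℕ => 2 * K * (1 / ((n : ℝ) + 1))) atTop (𝓝 0) := by
    simpa using (tendsto_one_div_add_atTop_nhds_zero_nat (𝕜 := ℝ)).const_mul (2 * K)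
  have hle : lam.real (Icc b (b + 1)) ≤ 0 := ge_of_tendsto' hlim hbound
  exact (measureReal_eq_zero_iff).mp (le_antisymm hle measureReal_nonneg)

lemma measure_lt_abs_eq_zero_of_Icc (lam : Measure ℝ) (R : ℝ)
    (h : ∀ b : ℝ, (∀ x ∈ Icc b (b + 1), R ≤ |x|) → lam (Icc b (b + 1)) = 0) :
    lam {x : ℝ | R < |x|} = 0 := by
  have hcover : {x : ℝ | R < |x|} ⊆ (⋃ n : ℕ, Icc (R + n) (R + n + 1)) ∪
      ⋃ n : ℕ, Icc (-R - n - 1) (-R - n - 1 + 1) := by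
    intro x hx
    have hx' : 0 ≤ |x| - R := by
      have : R < |x| := hx
      linarith
    have h1 := Nat.floor_le hx'
    have h2 := Nat.lt_floor_add_one (|x| - R)
    rcases abs_cases x with ⟨hx0, _⟩ | ⟨hx0, _⟩
    · exact Or.inl (mem_iUnion.mpr ⟨⌊|x| - R⌋₊, by constructor <;> linarith⟩)
    · exact Or.inr (mem_iUnion.mpr ⟨⌊|x| - R⌋₊, by constructor <;> linarith⟩)
  refine measure_mono_null hcover (measure_union_null (measure_iUnion_null fun n => h _ ?_)
    (measure_iUnion_null fun n => h _ ?_))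
  · intro x hx
    have := hx.1
    have : (0 : ℝ) ≤ n := n.cast_nonneg
    have := le_abs_self x
    linarith
  · intro x hx
    have := hx.2
    have : (0 : ℝ) ≤ n := n.cast_nonneg
    have := neg_le_abs x
    linarith

/-! ### Roots of `c³ + 2wc² + (w² + p)c + r` when `w²` dominates -/

lemma norm_cubic_root_ne_one {w p r c : ℂ} (hN : 16 ≤ ‖w ^ 2‖) (hw : 16 * ‖w‖ ≤ ‖w ^ 2‖)
    (hp : 16 * ‖p‖ ≤ ‖w ^ 2‖) (hr : 16 * ‖r‖ ≤ ‖w ^ 2‖)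
    (h : c ^ 3 + 2 * w * c ^ 2 + (w ^ 2 + p) * c + r = 0) : ‖c‖ ≠ 1 := by
  intro hc
  have hmain : w ^ 2 * c = -(c ^ 3 + 2 * w * c ^ 2 + p * c + r) := by linear_combination h
  have hnorm := congrArg norm hmain
  rw [norm_neg, norm_mul, hc, mul_one] at hnorm
  have h1 : ‖c ^ 3 + 2 * w * c ^ 2 + p * c + r‖
      ≤ ‖c ^ 3‖ + ‖2 * w * c ^ 2‖ + ‖p * c‖ + ‖r‖ := norm_add₄_le
  simp only [norm_mul, norm_pow, hc, one_pow, mul_one, Complex.norm_ofNat] at h1 hnorm hN hw hp hr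
  linarith

lemma norm_sub_conj_cubic_root_le {w p r c : ℂ} (hN : 16 ≤ ‖w ^ 2‖)
    (hw : 16 * ‖w‖ ≤ ‖w ^ 2‖) (hp : 16 * ‖p‖ ≤ ‖w ^ 2‖) (hc : ‖c‖ ≤ 1)
    (h : c ^ 3 + 2 * w * c ^ 2 + (w ^ 2 + p) * c + r = 0) :
    ‖c - conj c‖ ≤ 2 * ‖w - conj w‖ + ‖(w ^ 2 + p) - conj (w ^ 2 + p)‖ + ‖r - conj r‖ := by
  have hconj : conj c ^ 3 + 2 * conj w * conj c ^ 2 + conj (w ^ 2 + p) * conj c + conj r = 0 := by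
    simpa [Complex.conj_ofNat] using congrArg conj h
  set d := conj c with hd
  have hdn : ‖d‖ ≤ 1 := by rwa [hd, Complex.norm_conj]
  have hfac : (c - d) * (w ^ 2 - -(c * c + c * d + d * d + 2 * w * c + 2 * w * d + p))
      = -(2 * (w - conj w) * d ^ 2 + ((w ^ 2 + p) - conj (w ^ 2 + p)) * d + (r - conj r)) := by
    linear_combination h - hconj
  have hmul : ∀ {u v : ℂ}, ‖u‖ ≤ 1 → ‖v‖ ≤ 1 → ‖u * v‖ ≤ 1 := fun hu hv => by
    rw [norm_mul]
    exact mul_le_one₀ hu (norm_nonneg _) hv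
  have hwm : ∀ {u : ℂ}, ‖u‖ ≤ 1 → ‖2 * w * u‖ ≤ 2 * ‖w‖ := fun hu => by
    rw [norm_mul, norm_mul, Complex.norm_ofNat]
    exact mul_le_of_le_one_right (by positivity) hu
  have hlow : 1 ≤ ‖w ^ 2 - -(c * c + c * d + d * d + 2 * w * c + 2 * w * d + p)‖ := by
    have h1 := norm_sub_norm_le (w ^ 2) (-(c * c + c * d + d * d + 2 * w * c + 2 * w * d + p))
    rw [norm_neg] at h1
    have h2 := norm_add_le (c * c + c * d + d * d + 2 * w * c + 2 * w * d) p
    have h3 := norm_add_le (c * c + c * d + d * d + 2 * w * c) (2 * w * d)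
    have h4 := norm_add_le (c * c + c * d + d * d) (2 * w * c)
    have h5 := norm_add₃_le (a := c * c) (b := c * d) (c := d * d)
    linarith [hmul hc hc, hmul hc hdn, hmul hdn hdn, hwm hc, hwm hdn]
  have hnorm := congrArg norm hfac
  rw [norm_neg, norm_mul] at hnorm
  have hup := norm_add₃_le (a := 2 * (w - conj w) * d ^ 2)
    (b := ((w ^ 2 + p) - conj (w ^ 2 + p)) * d) (c := r - conj r)
  have hu1 : ‖2 * (w - conj w) * d ^ 2‖ ≤ 2 * ‖w - conj w‖ := by
    rw [norm_mul, norm_mul, Complex.norm_ofNat, norm_pow]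
    exact mul_le_of_le_one_right (by positivity) (pow_le_one₀ (norm_nonneg _) hdn)
  have hu2 : ‖((w ^ 2 + p) - conj (w ^ 2 + p)) * d‖ ≤ ‖(w ^ 2 + p) - conj (w ^ 2 + p)‖ := by
    rw [norm_mul]
    exact mul_le_of_le_one_right (norm_nonneg _) hdn
  have hge := le_mul_of_one_le_right (norm_nonneg (c - d)) hlow
  linarith

/-! ### Real polynomials at complex points -/

lemma eventually_norm_aeval_le {p q : ℝ[X]} (h : p.degree < q.degree) {ε : ℝ} (hε : 0 < ε) :
    ∀ᶠ z : ℂ in cobounded ℂ, ‖aeval z p‖ ≤ ε * ‖aeval z q‖ := by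
  have hdeg : (p.map (algebraMap ℝ ℂ)).degree < (q.map (algebraMap ℝ ℂ)).degree := by
    simpa using h
  simpa [eval_map_algebraMap] using (isLittleO_cobounded_of_degree_lt hdeg).bound hε

lemma exists_norm_aeval_sub_conj_le (p : ℝ[X]) (M : ℝ) :
    ∃ L : ℝ, ∀ z : ℂ, ‖z‖ ≤ M → ‖aeval z p - conj (aeval z p)‖ ≤ L * |z.im| := by
  have hsmooth : ContDiff ℝ 1 fun z : ℂ => aeval z p := by
    simpa only [eval_map_algebraMap, Polynomial.coe_aeval_eq_eval] using
      ((p.map (algebraMap ℝ ℂ)).contDiff_aeval (𝕜 := ℂ) 1).restrict_scalars ℝ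
  obtain ⟨K, hK⟩ := hsmooth.contDiffOn.exists_lipschitzOnWith one_ne_zero
    (convex_closedBall (0 : ℂ) M) (isCompact_closedBall 0 M)
  refine ⟨K * 2, fun z hz => ?_⟩
  have h := hK.dist_le_mul z (by simpa using hz) (conj z) (by simpa using hz)
  rw [aeval_conj, dist_eq_norm, dist_eq_norm, Complex.sub_conj, Complex.sub_conj] at h
  rw [Complex.sub_conj]
  simpa [mul_assoc] using h

/-! ### The Cauchy transform on an admissible spectral curve -/

namespace AdmissibleSpectralCurve

variable {V : ℝ[X]} {a α : ℝ} {p₀ p₁ : ℝ[X]} {lam : Measure ℝ}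

lemma cauchyT_cubic (h : AdmissibleSpectralCurve V a α p₀ p₁ lam) {z : ℂ} (hz : z.im ≠ 0) :
    cauchyT lam z ^ 3 + 2 * aeval z V.derivative * cauchyT lam z ^ 2
      + (aeval z V.derivative ^ 2 + aeval z p₁) * cauchyT lam z
      + aeval z (p₁ * V.derivative + p₀) = 0 := by
  have := h.hsol z hz
  rw [xi1] at this
  rw [map_add, map_mul]
  linear_combination this

lemma eventually_dominated (h : AdmissibleSpectralCurve V a α p₀ p₁ lam) :
    ∀ᶠ z : ℂ in cobounded ℂ, 16 ≤ ‖aeval z V.derivative ^ 2‖ ∧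
      16 * ‖aeval z V.derivative‖ ≤ ‖aeval z V.derivative ^ 2‖ ∧
      16 * ‖aeval z p₁‖ ≤ ‖aeval z V.derivative ^ 2‖ ∧
      16 * ‖aeval z (p₁ * V.derivative + p₀)‖ ≤ ‖aeval z V.derivative ^ 2‖ := by
  have hm := h.hdeg
  have hW : V.derivative.degree = ((V.natDegree - 1 : ℕ) : WithBot ℕ) :=
    degree_derivative (by omega)
  have hWn : V.derivative.natDegree = V.natDegree - 1 := natDegree_eq_of_degree_eq_some hW
  have hW0 : V.derivative ≠ 0 := by
    intro h0
    rw [h0, natDegree_zero] at hWn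
    omega
  have hW2 : (V.derivative ^ 2).natDegree = 2 * (V.natDegree - 1) := by rw [natDegree_pow, hWn]
  have hp₁ : p₁.natDegree ≤ V.natDegree - 2 := natDegree_le_of_degree_le h.hp₁
  have hr : (p₁ * V.derivative + p₀).natDegree ≤ 2 * (V.natDegree - 1) - 1 := by
    refine natDegree_add_le_of_degree_le ?_ (h.hp₀deg.trans (by omega))
    refine natDegree_mul_le.trans ?_
    omega
  have hlt : ∀ {p : ℝ[X]}, p.natDegree < 2 * (V.natDegree - 1) →
      p.degree < (V.derivative ^ 2).degree := fun hp =>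
    degree_lt_degree (by rwa [hW2])
  have h16 : (0 : ℝ) < 1 / 16 := by norm_num
  filter_upwards [eventually_norm_aeval_le (p := 1) (hlt (by simp; omega)) h16,
    eventually_norm_aeval_le (hlt (p := V.derivative) (by omega)) h16,
    eventually_norm_aeval_le (hlt (p := p₁) (by omega)) h16,
    eventually_norm_aeval_le (hlt (p := p₁ * V.derivative + p₀) (by omega)) h16]
    with z h1 h2 h3 h4
  rw [map_pow] at h1 h2 h3 h4
  rw [map_one, norm_one] at h1
  exact ⟨by linarith, by linarith, by linarith, by linarith⟩

end AdmissibleSpectralCurve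

/-- **The measure `λ` of an admissible spectral curve has compact support.** -/
theorem stmt13 (V : Polynomial ℝ) (a α : ℝ) (p₀ p₁ : Polynomial ℝ) (lam : Measure ℝ)
    (h : AdmissibleSpectralCurve V a α p₀ p₁ lam) :
    ∃ R : ℝ, 0 < R ∧ lam {x : ℝ | R < |x|} = 0 := by
  have hprob := h.hprob
  obtain ⟨R, -, hR⟩ := (hasBasis_cobounded_norm (E := ℂ)).eventually_iff.mp
    h.eventually_dominated
  have hne : ∀ z : ℂ, max R 1 ≤ ‖z‖ → z.im ≠ 0 → ‖cauchyT lam z‖ ≠ 1 := fun z hz hz0 => by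
    obtain ⟨h1, h2, h3, h4⟩ := hR ((le_max_left _ _).trans hz)
    exact norm_cubic_root_ne_one h1 h2 h3 h4 (h.cauchyT_cubic hz0)
  refine ⟨max R 1, by positivity, measure_lt_abs_eq_zero_of_Icc lam _ fun b hb => ?_⟩
  obtain ⟨L₁, hL₁⟩ := exists_norm_aeval_sub_conj_le V.derivative (|b| + 2)
  obtain ⟨L₂, hL₂⟩ := exists_norm_aeval_sub_conj_le (V.derivative ^ 2 + p₁) (|b| + 2)
  obtain ⟨L₃, hL₃⟩ := exists_norm_aeval_sub_conj_le (p₁ * V.derivative + p₀) (|b| + 2)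
  refine measure_Icc_eq_zero_of_quadratic_bound lam b (2 * L₁ + L₂ + L₃) fun x hx y hy hy1 => ?_
  have hxR := hb x hx
  have hzM : ‖(⟨x, y⟩ : ℂ)‖ ≤ |b| + 2 := by
    have h1 : ‖(⟨x, y⟩ : ℂ)‖ ≤ |x| + |y| := Complex.norm_le_abs_re_add_abs_im _
    have h2 : |x| ≤ |b| + 1 := by
      have := neg_abs_le b
      have := le_abs_self b
      exact abs_le.mpr ⟨by linarith [hx.1], by linarith [hx.2]⟩
    rw [abs_of_pos hy] at h1
    linarith
  obtain ⟨h1, h2, h3, -⟩ :=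
    hR (((le_max_left _ _).trans hxR).trans (Complex.abs_re_le_norm ⟨x, y⟩))
  have him := norm_sub_conj_cubic_root_le h1 h2 h3 (norm_cauchyT_le_one lam hne hxR hy)
    (h.cauchyT_cubic (z := ⟨x, y⟩) hy.ne')
  have hd₁ := hL₁ _ hzM
  have hd₂ := hL₂ _ hzM
  have hd₃ := hL₃ _ hzM
  rw [map_add, map_pow] at hd₂
  rw [abs_of_pos (show 0 < (⟨x, y⟩ : ℂ).im from hy)] at hd₁ hd₂ hd₃
  rw [Complex.sub_conj, norm_mul, Complex.norm_I, mul_one, Complex.norm_real,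
    Real.norm_eq_abs] at him
  have hmass := measureReal_Icc_le_im_cauchyT lam x hy
  have hC : 2 * (cauchyT lam ⟨x, y⟩).im ≤ (2 * L₁ + L₂ + L₃) * y := by
    have := le_abs_self (2 * (cauchyT lam ⟨x, y⟩).im)
    linarith
  have := mul_le_mul_of_nonneg_left hC hy.le
  linarith
end
end
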